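/- arXiv:1106.3156 — 2 statements merged into one kernel-verified Lean document; each statement's English description precedes it below -/
import Mathlib

section
/- For every properly convex open set Ω ⊆ ℙⁿ(ℝ) and every point x ∈ Ω, there exists a unique affine chart of ℙⁿ(ℝ) in which Ω is bounded and x is the center of mass of Ω. -/
open MeasureTheory

noncomputable section

variable {n : ℕ}

/-- A proper open convex cone in `ℝ^{n+1}`: open, convex, stable under positive scaling,
avoiding the origin, and whose closure contains no line through the origin. -/
def IsPCone (C : Set (Fin (n + 1) → ℝ)) : Prop :=
  IsOpen C ∧ Convex ℝ C ∧ C.Nonempty ∧ (0 : Fin (n + 1) → ℝ) ∉ C ∧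
    (∀ c : ℝ, 0 < c → ∀ v ∈ C, c • v ∈ C) ∧
    closure C ∩ (-(closure C)) ⊆ {0}

/-- The subset of `ℙⁿ(ℝ)` obtained by projectivizing a cone. -/
def projOf (C : Set (Fin (n + 1) → ℝ)) : Set (Projectivization ℝ (Fin (n + 1) → ℝ)) :=
  {x | ∃ v, ∃ hv : v ≠ 0, v ∈ C ∧ Projectivization.mk ℝ v hv = x}

/-- `Ω ⊆ ℙⁿ(ℝ)` is properly convex open iff it is the projectivization of a proper open
convex cone. -/
def IsProperlyConvexOpen (Ω : Set (Projectivization ℝ (Fin (n + 1) → ℝ))) : Prop :=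
  ∃ C, IsPCone C ∧ Ω = projOf C

/-- The affine chart of `ℙⁿ(ℝ)` defined by a nonzero linear functional `f`:
the complement of the projective hyperplane `{f = 0}`. -/
def chart (f : (Fin (n + 1) → ℝ) →ₗ[ℝ] ℝ) : Set (Projectivization ℝ (Fin (n + 1) → ℝ)) :=
  {x | f x.rep ≠ 0}

/-- Dehomogenization: the representative of `x` lying on the affine hyperplane `{f = 1}`. -/
def dehom (f : (Fin (n + 1) → ℝ) →ₗ[ℝ] ℝ) (x : Projectivization ℝ (Fin (n + 1) → ℝ)) :
    Fin (n + 1) → ℝ :=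
  (f x.rep)⁻¹ • x.rep

/-- `Ω` is bounded in the chart `f` and `x` is the center of mass of `Ω` in this chart,
the latter computed through any affine parametrization `A : ℝⁿ ≃ {f = 1}` of the chart
(the center of mass does not depend on this choice). -/
def IsBoundedWithBarycenter (f : (Fin (n + 1) → ℝ) →ₗ[ℝ] ℝ)
    (Ω : Set (Projectivization ℝ (Fin (n + 1) → ℝ)))
    (x : Projectivization ℝ (Fin (n + 1) → ℝ)) : Prop :=
  Ω ⊆ chart f ∧ Bornology.IsBounded (dehom f '' Ω) ∧
    ∀ A : (Fin n → ℝ) →ᵃ[ℝ] (Fin (n + 1) → ℝ), Function.Injective A →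
      Set.range A = {v | f v = 1} →
      A (⨍ p in A ⁻¹' (dehom f '' Ω), p) = dehom f x

end

open Set Filter Topology Metric

section Cone

variable {E : Type*} [NormedAddCommGroup E] [NormedSpace ℝ E] {C : Set E}

/-- Adding a point of the closure of an open convex cone keeps one inside the cone. -/
theorem add_mem_of_mem_closure_cone (hO : IsOpen C) (hC : Convex ℝ C)
    (hs : ∀ c : ℝ, 0 < c → ∀ v ∈ C, c • v ∈ C) {u w : E} (hu : u ∈ C) (hw : w ∈ closure C) :
    u + w ∈ C := by
  have h1 : (1 / 2 : ℝ) • u + (1 / 2 : ℝ) • w ∈ interior C :=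
    hC.combo_interior_closure_mem_interior (hO.interior_eq.symm ▸ hu) hw (by norm_num)
      (by norm_num) (by norm_num)
  have h2 := hs 2 (by norm_num) _ (interior_subset h1)
  simpa [smul_smul] using h2

theorem smul_mem_closure_cone (hs : ∀ c : ℝ, 0 < c → ∀ v ∈ C, c • v ∈ C) {c : ℝ} (hc : 0 < c)
    {w : E} (hw : w ∈ closure C) : c • w ∈ closure C :=
  map_mem_closure (continuous_const_smul c) hw (fun v hv => hs c hc v hv)

theorem zero_mem_closure_cone (hs : ∀ c : ℝ, 0 < c → ∀ v ∈ C, c • v ∈ C) (hne : C.Nonempty) :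
    (0 : E) ∈ closure C := by
  obtain ⟨v, hv⟩ := hne
  have h : Tendsto (fun c : ℝ => c • v) (𝓝[>] 0) (𝓝 ((0 : ℝ) • v)) :=
    ((continuous_id.smul continuous_const).tendsto 0).mono_left nhdsWithin_le_nhds
  rw [zero_smul] at h
  exact mem_closure_of_tendsto h (eventually_mem_nhdsWithin.mono fun c hc => hs c hc v hv)

/-- A functional that is positive on the nonzero vectors of the closure of a cone dominates
the norm on the cone. -/
theorem exists_norm_le_mul_of_pos [FiniteDimensional ℝ E]
    (hs : ∀ c : ℝ, 0 < c → ∀ v ∈ C, c • v ∈ C) (f : E →L[ℝ] ℝ)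
    (hf : ∀ w ∈ closure C, w ≠ 0 → 0 < f w) : ∃ R : ℝ, 0 < R ∧ ∀ v ∈ C, ‖v‖ ≤ R * f v := by
  have hcomp : IsCompact (closure C ∩ sphere (0 : E) 1) :=
    (isCompact_sphere 0 1).inter_left isClosed_closure
  have key : ∃ m : ℝ, 0 < m ∧ ∀ w ∈ closure C ∩ sphere (0 : E) 1, m ≤ f w := by
    rcases (closure C ∩ sphere (0 : E) 1).eq_empty_or_nonempty with h | h
    · exact ⟨1, one_pos, by simp [h]⟩
    · obtain ⟨w, hw, hmin⟩ := hcomp.exists_isMinOn h f.continuous.continuousOn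
      refine ⟨f w, hf w hw.1 ?_, fun z hz => hmin hz⟩
      exact ne_zero_of_mem_sphere one_ne_zero ⟨w, hw.2⟩
  obtain ⟨m, hm, hmle⟩ := key
  refine ⟨m⁻¹, inv_pos.2 hm, fun v hv => ?_⟩
  rcases eq_or_ne v 0 with rfl | hv0
  · simp
  · have hn : 0 < ‖v‖ := norm_pos_iff.2 hv0
    have h := hmle (‖v‖⁻¹ • v) ⟨subset_closure (hs _ (inv_pos.2 hn) v hv), by
      simp [norm_smul, hn.ne']⟩
    rw [map_smul, smul_eq_mul, inv_mul_eq_div, le_div_iff₀ hn] at h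
    rw [inv_mul_eq_div, le_div_iff₀ hm]
    linarith

/-- The dual cone of a salient convex cone contains a functional that is positive on all nonzero
vectors of the closure. -/
theorem exists_pos_functional [FiniteDimensional ℝ E] (hC : Convex ℝ C) (hne : C.Nonempty)
    (hs : ∀ c : ℝ, 0 < c → ∀ v ∈ C, c • v ∈ C) (hsal : closure C ∩ (-(closure C)) ⊆ {0}) :
    ∃ f : E →L[ℝ] ℝ, ∀ w ∈ closure C, w ≠ 0 → 0 < f w := by
  have hcomp : IsCompact (closure C ∩ sphere (0 : E) 1) :=
    (isCompact_sphere 0 1).inter_left isClosed_closure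
  have hsep : ∀ w ∈ closure C ∩ sphere (0 : E) 1,
      ∃ f : E →L[ℝ] ℝ, (∀ v ∈ closure C, 0 ≤ f v) ∧ 0 < f w := by
    intro w hw
    have hw0 : w ≠ 0 := ne_zero_of_mem_sphere one_ne_zero ⟨w, hw.2⟩
    have hnw : -w ∉ closure C := fun h => hw0 (hsal ⟨hw.1, h⟩)
    obtain ⟨f, u, hfu, huf⟩ := geometric_hahn_banach_point_closed hC.closure isClosed_closure hnw
    have hu : u < 0 := by simpa using huf 0 (zero_mem_closure_cone hs hne)
    refine ⟨f, fun v hv => ?_, ?_⟩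
    · by_contra! hneg
      have h := huf _ (smul_mem_closure_cone hs (c := u / f v) (div_pos_of_neg_of_neg hu hneg) hv)
      rw [map_smul, smul_eq_mul, div_mul_cancel₀ _ hneg.ne] at h
      exact lt_irrefl _ h
    · rw [map_neg] at hfu
      linarith
  choose! F hF0 hF1 using hsep
  obtain ⟨t, ht, hcov⟩ := hcomp.elim_nhds_subcover (fun w => {z | 0 < F w z})
    (fun w hw => (isOpen_lt continuous_const (F w).continuous).mem_nhds (hF1 w hw))
  refine ⟨∑ w ∈ t, F w, fun v hv hv0 => ?_⟩
  have hn : 0 < ‖v‖ := norm_pos_iff.2 hv0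
  obtain ⟨w, hwt, hw⟩ := mem_iUnion₂.1 (hcov (a := ‖v‖⁻¹ • v)
    ⟨smul_mem_closure_cone hs (inv_pos.2 hn) hv, by simp [norm_smul, hn.ne']⟩)
  have hw' : 0 < F w v := by
    have h : 0 < F w (‖v‖⁻¹ • v) := hw
    rw [map_smul, smul_eq_mul] at h
    exact pos_of_mul_pos_right h (inv_pos.2 hn).le
  rw [sum_apply]
  exact Finset.sum_pos' (fun z hz => hF0 z (ht z hz) v hv) ⟨w, hwt, hw'⟩

theorem isCompact_dual_slice [FiniteDimensional ℝ E] (hO : IsOpen C) {v₀ : E} (hv₀ : v₀ ∈ C) :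
    IsCompact {f : E →L[ℝ] ℝ | f v₀ = 1 ∧ ∀ v ∈ C, 0 ≤ f v} := by
  obtain ⟨δ, hδ, hball⟩ := Metric.isOpen_iff.1 hO v₀ hv₀
  refine Metric.isCompact_of_isClosed_isBounded ?_ ?_
  · simp only [ofPred_and, ofPred_forall]
    refine (isClosed_eq (by fun_prop) continuous_const).inter ?_
    exact isClosed_iInter fun v => isClosed_iInter fun _ => isClosed_le continuous_const (by fun_prop)
  · refine (isBounded_closedBall (x := (0 : E →L[ℝ] ℝ)) (r := 2 / δ)).subset ?_
    rintro f ⟨hf1, hf⟩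
    rw [mem_closedBall_zero_iff]
    refine f.opNorm_le_bound (by positivity) fun u => ?_
    rcases eq_or_ne u 0 with rfl | hu
    · simp
    have hn : 0 < ‖u‖ := norm_pos_iff.2 hu
    have hz : ‖(δ / (2 * ‖u‖)) • u‖ < δ := by
      rw [norm_smul, Real.norm_of_nonneg (by positivity)]
      field_simp
      linarith
    have h1 := hf (v₀ + (δ / (2 * ‖u‖)) • u) (hball (by simpa using hz))
    have h2 := hf (v₀ - (δ / (2 * ‖u‖)) • u) (hball (by simpa [dist_eq_norm] using hz))
    rw [map_add, map_smul, hf1, smul_eq_mul] at h1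
    rw [map_sub, map_smul, hf1, smul_eq_mul] at h2
    have h3 : |δ / (2 * ‖u‖) * f u| ≤ 1 := abs_le.2 ⟨by linarith, by linarith⟩
    rw [abs_mul, abs_of_pos (by positivity), div_mul_eq_mul_div, div_le_one (by positivity)] at h3
    rw [Real.norm_eq_abs, div_mul_eq_mul_div, le_div_iff₀ hδ]
    linarith

theorem norm_le_mul_of_norm_mul_le {f g : E →L[ℝ] ℝ} {R : ℝ} (hR : 0 < R)
    (hf : ∀ v ∈ C, ‖v‖ ≤ R * f v) {t : ℝ} (ht : |t| * (2 * R * ‖g‖) ≤ 1) :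
    ∀ v ∈ C, ‖v‖ ≤ 2 * R * (f + t • g) v := by
  intro v hv
  have h1 : |t * g v| * (2 * R) ≤ ‖v‖ := by
    calc |t * g v| * (2 * R) ≤ |t| * (‖g‖ * ‖v‖) * (2 * R) := by
          rw [abs_mul]
          gcongr
          exact g.le_opNorm v
      _ = |t| * (2 * R * ‖g‖) * ‖v‖ := by ring
      _ ≤ 1 * ‖v‖ := by gcongr
      _ = ‖v‖ := one_mul _
  have h2 := hf v hv
  have h3 := neg_abs_le (t * g v)
  simp only [add_apply, smul_apply, smul_eq_mul]
  nlinarith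

end Cone

section Integrals

variable {E : Type*} [NormedAddCommGroup E] [NormedSpace ℝ E]
  [MeasurableSpace E] [BorelSpace E] (μ : Measure E) {C : Set E}

theorem lowerSemicontinuous_lintegral_exp_neg :
    LowerSemicontinuous fun f : E →L[ℝ] ℝ => ∫⁻ v in C, ENNReal.ofReal (Real.exp (-f v)) ∂μ := by
  rw [lowerSemicontinuous_iff_le_liminf]
  intro f
  refine le_trans (le_of_eq ?_) (lintegral_liminf_le (u := 𝓝 f)
    (f := fun (g : E →L[ℝ] ℝ) v => ENNReal.ofReal (Real.exp (-g v))) fun g => by fun_prop)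
  congr 1
  ext v
  have : Continuous fun g : E →L[ℝ] ℝ => ENNReal.ofReal (Real.exp (-g v)) :=
    ENNReal.continuous_ofReal.comp (by fun_prop)
  exact ((this.tendsto f).liminf_eq).symm

variable [μ.IsAddHaarMeasure]

/-- The characteristic function of a cone is finite only at functionals that are positive on the
nonzero vectors of its closure. -/
theorem pos_of_lintegral_exp_neg_ne_top (hO : IsOpen C) (hC : Convex ℝ C) (hne : C.Nonempty)
    (hs : ∀ c : ℝ, 0 < c → ∀ v ∈ C, c • v ∈ C) (hsal : closure C ∩ (-(closure C)) ⊆ {0})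
    {f : E →L[ℝ] ℝ} (hf : ∀ v ∈ C, 0 ≤ f v)
    (hfin : ∫⁻ v in C, ENNReal.ofReal (Real.exp (-f v)) ∂μ ≠ ⊤) :
    ∀ w ∈ closure C, w ≠ 0 → 0 < f w := by
  intro w hw hw0
  have hfw : 0 ≤ f w :=
    closure_minimal (t := {v | 0 ≤ f v}) hf (isClosed_le continuous_const f.continuous) hw
  refine hfw.lt_of_ne' fun hfw0 => hw0 (hsal ⟨hw, ?_⟩)
  have hmeas : Measurable fun v : E => ENNReal.ofReal (Real.exp (-f v)) := by fun_prop
  have hnull : ∀ k : ℕ, ∀ᵐ v ∂μ, v ∈ C → v - (k : ℝ) • w ∈ C := by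
    intro k
    set T : Set E := {v | v - (k : ℝ) • w ∈ C} with hT
    have hTO : IsOpen T := hO.preimage (by fun_prop)
    have hTC : T ⊆ C := by
      intro v hv
      rcases Nat.eq_zero_or_pos k with rfl | hk
      · simpa [hT] using hv
      · have := add_mem_of_mem_closure_cone hO hC hs hv
          (smul_mem_closure_cone hs (Nat.cast_pos.2 hk : (0 : ℝ) < k) hw)
        simpa using this
    have hshift : ∫⁻ v in T, ENNReal.ofReal (Real.exp (-f v)) ∂μ
        = ∫⁻ v in C, ENNReal.ofReal (Real.exp (-f v)) ∂μ := by
      rw [← lintegral_indicator hTO.measurableSet, ← lintegral_indicator hO.measurableSet,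
        ← lintegral_sub_right_eq_self (C.indicator _) ((k : ℝ) • w)]
      congr 1
      ext v
      by_cases h : v - (k : ℝ) • w ∈ C
      · rw [indicator_of_mem h, indicator_of_mem (show v ∈ T from h)]
        simp [hfw0]
      · rw [indicator_of_notMem h, indicator_of_notMem (show v ∉ T from h)]
    have hdiff : ∫⁻ v in C \ T, ENNReal.ofReal (Real.exp (-f v)) ∂μ = 0 := by
      have h := lintegral_inter_add_sdiff (μ := μ)
        (fun v : E => ENNReal.ofReal (Real.exp (-f v))) C hTO.measurableSet
      rw [inter_eq_self_of_subset_right hTC, hshift] at h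
      exact (ENNReal.add_right_inj hfin).1 (h.trans (add_zero _).symm)
    rw [setLIntegral_eq_zero_iff (hO.measurableSet.diff hTO.measurableSet) hmeas] at hdiff
    filter_upwards [hdiff] with v hv hvC
    by_contra hvT
    have := hv ⟨hvC, hvT⟩
    exact (ENNReal.ofReal_pos.2 (Real.exp_pos _)).ne' this
  have hex : ∃ v ∈ C, ∀ k : ℕ, v - (k : ℝ) • w ∈ C := by
    by_contra! hcon
    refine (hO.measure_pos μ hne).ne' (measure_mono_null ?_ (ae_iff.1 (ae_all_iff.2 hnull)))
    intro v hv
    obtain ⟨k, hk⟩ := hcon v hv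
    simp only [mem_ofPred_eq, not_forall]
    exact ⟨k, hv, hk⟩
  obtain ⟨v, -, hv⟩ := hex
  have hlim : Tendsto (fun k : ℕ => ((k : ℝ) + 1)⁻¹ • (v - ((k + 1 : ℕ) : ℝ) • w)) atTop
      (𝓝 ((0 : ℝ) • v - w)) := by
    have h1 : Tendsto (fun k : ℕ => ((k : ℝ) + 1)⁻¹) atTop (𝓝 0) := by
      simpa using tendsto_one_div_add_atTop_nhds_zero_nat (𝕜 := ℝ)
    refine ((h1.smul_const v).sub_const w).congr fun k => ?_
    have : (k : ℝ) + 1 ≠ 0 := by positivity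
    rw [smul_sub, smul_smul]
    push_cast
    rw [inv_mul_cancel₀ this, one_smul]
  rw [zero_smul, zero_sub] at hlim
  exact mem_closure_of_tendsto hlim
    (Eventually.of_forall fun k => hs _ (by positivity) _ (hv (k + 1)))

variable [FiniteDimensional ℝ E]

theorem integrable_one_add_norm_mul_exp_neg {b : ℝ} (hb : 0 < b) :
    Integrable (fun v : E => (1 + ‖v‖) * Real.exp (-(b * ‖v‖))) μ := by
  set N := Module.finrank ℝ E + 2 with hN
  have hint := integrable_one_add_norm (E := E) (μ := μ) (r := (Module.finrank ℝ E + 1 : ℕ))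
    (by push_cast; linarith)
  refine (hint.const_mul (N.factorial * Real.exp b / b ^ N)).mono' (by fun_prop)
    (Eventually.of_forall fun v => ?_)
  have hn : 0 < 1 + ‖v‖ := by positivity
  have h := Real.pow_div_factorial_le_exp (b * (1 + ‖v‖)) (by positivity) N
  rw [Real.norm_of_nonneg (by positivity), Real.rpow_neg hn.le, Real.rpow_natCast, Real.exp_neg,
    ← div_eq_mul_inv, ← div_eq_mul_inv, div_div, div_le_div_iff₀ (by positivity) (by positivity)]
  rw [mul_add, mul_one, Real.exp_add, div_le_iff₀ (by positivity)] at h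
  calc (1 + ‖v‖) * (b ^ N * (1 + ‖v‖) ^ (Module.finrank ℝ E + 1))
      = (b + b * ‖v‖) ^ N := by rw [← mul_one_add b, mul_pow, hN]; ring
    _ ≤ _ := by linarith

theorem integrableOn_one_add_norm_mul_exp_neg (hO : IsOpen C) {f : E →L[ℝ] ℝ} {R : ℝ}
    (hR : 0 < R) (hf : ∀ v ∈ C, ‖v‖ ≤ R * f v) :
    IntegrableOn (fun v => (1 + ‖v‖) * Real.exp (-f v)) C μ := by
  refine (integrable_one_add_norm_mul_exp_neg μ (inv_pos.2 hR)).integrableOn.mono'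
    (by fun_prop) ?_
  filter_upwards [ae_restrict_mem hO.measurableSet] with v hv
  rw [Real.norm_of_nonneg (by positivity)]
  gcongr
  rw [inv_mul_le_iff₀ hR]
  exact hf v hv

theorem integrableOn_exp_neg (hO : IsOpen C) {f : E →L[ℝ] ℝ} {R : ℝ}
    (hR : 0 < R) (hf : ∀ v ∈ C, ‖v‖ ≤ R * f v) :
    IntegrableOn (fun v => Real.exp (-f v)) C μ := by
  refine (integrableOn_one_add_norm_mul_exp_neg μ hO hR hf).mono' (by fun_prop)
    (Eventually.of_forall fun v => ?_)
  rw [Real.norm_of_nonneg (by positivity)]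
  nlinarith [Real.exp_pos (-f v), norm_nonneg v]

theorem integrableOn_mul_exp_neg (hO : IsOpen C) {f : E →L[ℝ] ℝ} {R : ℝ}
    (hR : 0 < R) (hf : ∀ v ∈ C, ‖v‖ ≤ R * f v) (g : E →L[ℝ] ℝ) :
    IntegrableOn (fun v => g v * Real.exp (-f v)) C μ := by
  refine ((integrableOn_one_add_norm_mul_exp_neg μ hO hR hf).const_mul ‖g‖).mono' (by fun_prop)
    (Eventually.of_forall fun v => ?_)
  rw [norm_mul, Real.norm_of_nonneg (Real.exp_pos _).le, ← mul_assoc]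
  gcongr
  exact (g.le_opNorm v).trans (by gcongr; linarith)

theorem hasDerivAt_integral_exp_neg (hO : IsOpen C) {f : E →L[ℝ] ℝ} {R : ℝ}
    (hR : 0 < R) (hf : ∀ v ∈ C, ‖v‖ ≤ R * f v) (g : E →L[ℝ] ℝ) :
    HasDerivAt (fun t : ℝ => ∫ v in C, Real.exp (-(f + t • g) v) ∂μ)
      (∫ v in C, -(g v * Real.exp (-f v)) ∂μ) 0 := by
  set ε : ℝ := (2 * R * ‖g‖ + 1)⁻¹ with hε
  have hε0 : 0 < ε := by positivity
  have hball : ∀ t ∈ ball (0 : ℝ) ε, |t| * (2 * R * ‖g‖) ≤ 1 := by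
    intro t ht
    rw [mem_ball_zero_iff, Real.norm_eq_abs] at ht
    calc |t| * (2 * R * ‖g‖) ≤ ε * (2 * R * ‖g‖ + 1) := by gcongr; linarith
      _ = 1 := inv_mul_cancel₀ (by positivity)
  have hb := (integrable_one_add_norm_mul_exp_neg μ
    (inv_pos.2 (by positivity : 0 < 2 * R))).integrableOn (s := C) |>.const_mul ‖g‖
  have h := hasDerivAt_integral_of_dominated_loc_of_deriv_le (μ := μ.restrict C)
    (F := fun (t : ℝ) v => Real.exp (-(f + t • g) v))
    (F' := fun (t : ℝ) v => -(g v * Real.exp (-(f + t • g) v))) (x₀ := 0)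
    (ball_mem_nhds 0 hε0) (Eventually.of_forall fun t => by fun_prop)
    (by simpa using (integrableOn_exp_neg μ hO hR hf).integrable) (by fun_prop) ?_ hb ?_
  · simpa using h.2
  · filter_upwards [ae_restrict_mem hO.measurableSet] with v hv t ht
    have hfv := norm_le_mul_of_norm_mul_le hR hf (hball t ht) v hv
    rw [norm_neg, norm_mul, Real.norm_of_nonneg (Real.exp_pos _).le, ← mul_assoc]
    have hg : ‖g v‖ ≤ ‖g‖ * (1 + ‖v‖) := (g.le_opNorm v).trans (by gcongr; linarith)
    gcongr
    rwa [inv_mul_le_iff₀ (by positivity)]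
  · refine Eventually.of_forall fun v t _ => ?_
    have h1 : HasDerivAt (fun t : ℝ => -(f + t • g) v) (-g v) t := by
      refine (((hasDerivAt_id t).mul_const (g v)).const_add (f v)).neg.congr_deriv ?_
      rw [one_mul]
    simpa [mul_comm] using h1.exp

/-- The restriction of the characteristic function of a salient cone to a slice of the dual cone
has a critical point. -/
theorem exists_critical_functional (hO : IsOpen C) (hC : Convex ℝ C)
    (hs : ∀ c : ℝ, 0 < c → ∀ v ∈ C, c • v ∈ C) (h0 : (0 : E) ∉ C)
    (hsal : closure C ∩ (-(closure C)) ⊆ {0}) {v₀ : E} (hv₀ : v₀ ∈ C) :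
    ∃ f : E →L[ℝ] ℝ, f v₀ = 1 ∧ (∃ R, 0 < R ∧ ∀ v ∈ C, ‖v‖ ≤ R * f v) ∧
      ∀ g : E →L[ℝ] ℝ, g v₀ = 0 → ∫ v in C, g v * Real.exp (-f v) ∂μ = 0 := by
  have hfin : ∀ {f : E →L[ℝ] ℝ} {R : ℝ}, 0 < R → (∀ v ∈ C, ‖v‖ ≤ R * f v) →
      ENNReal.ofReal (∫ v in C, Real.exp (-f v) ∂μ)
        = ∫⁻ v in C, ENNReal.ofReal (Real.exp (-f v)) ∂μ := fun hR hf =>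
    ofReal_integral_eq_lintegral_ofReal (integrableOn_exp_neg μ hO hR hf)
      (Eventually.of_forall fun v => (Real.exp_pos _).le)
  have hnonneg : ∀ {f : E →L[ℝ] ℝ} {R : ℝ}, 0 < R → (∀ v ∈ C, ‖v‖ ≤ R * f v) →
      ∀ v ∈ C, 0 ≤ f v := fun hR hf v hv =>
    nonneg_of_mul_nonneg_right ((norm_nonneg v).trans (hf v hv)) hR
  obtain ⟨p, hp⟩ := exists_pos_functional hC ⟨v₀, hv₀⟩ hs hsal
  have hp0 : 0 < p v₀ := hp v₀ (subset_closure hv₀) (ne_of_mem_of_not_mem hv₀ h0)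
  obtain ⟨R₁, hR₁, hR₁p⟩ := exists_norm_le_mul_of_pos hs ((p v₀)⁻¹ • p) fun w hw hw0 => by
    simpa using mul_pos (inv_pos.2 hp0) (hp w hw hw0)
  have hpS : (p v₀)⁻¹ • p ∈ {f : E →L[ℝ] ℝ | f v₀ = 1 ∧ ∀ v ∈ C, 0 ≤ f v} :=
    ⟨by simp [hp0.ne'], hnonneg hR₁ hR₁p⟩
  obtain ⟨f, ⟨hf1, hf0⟩, hmin⟩ := LowerSemicontinuousOn.exists_isMinOn ⟨_, hpS⟩
    (isCompact_dual_slice hO hv₀)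
    ((lowerSemicontinuous_lintegral_exp_neg (C := C) μ).lowerSemicontinuousOn _)
  have hff : ∫⁻ v in C, ENNReal.ofReal (Real.exp (-f v)) ∂μ ≠ ⊤ := by
    refine ((hmin hpS).trans_lt ?_).ne
    beta_reduce
    rw [← hfin hR₁ hR₁p]
    exact ENNReal.ofReal_lt_top
  obtain ⟨R, hR, hRf⟩ := exists_norm_le_mul_of_pos hs f
    (pos_of_lintegral_exp_neg_ne_top μ hO hC ⟨v₀, hv₀⟩ hs hsal hf0 hff)
  refine ⟨f, hf1, ⟨R, hR, hRf⟩, fun g hg => ?_⟩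
  have hloc : IsLocalMin (fun t : ℝ => ∫ v in C, Real.exp (-(f + t • g) v) ∂μ) 0 := by
    have hsmall : ∀ᶠ t : ℝ in 𝓝 0, |t| * (2 * R * ‖g‖) < 1 := by
      refine ContinuousAt.eventually_lt (by fun_prop) (by fun_prop) (by simp)
    filter_upwards [hsmall] with t ht
    have hft := norm_le_mul_of_norm_mul_le hR hRf ht.le
    have h := hmin (a := f + t • g) ⟨by simp [hf1, hg], hnonneg (by positivity) hft⟩
    rw [mem_ofPred_eq] at h
    beta_reduce at h
    rw [← hfin hR hRf, ← hfin (by positivity) hft,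
      ENNReal.ofReal_le_ofReal_iff (integral_nonneg fun v => (Real.exp_pos _).le)] at h
    simpa using h
  have h := hloc.hasDerivAt_eq_zero (hasDerivAt_integral_exp_neg μ hO hR hRf g)
  rwa [integral_neg, neg_eq_zero] at h

/-- The critical point of the characteristic function of a cone on a slice of the dual cone is
unique. -/
theorem critical_functional_unique (hO : IsOpen C) {v₀ : E} (hv₀ : v₀ ∈ C)
    {f₁ f₂ : E →L[ℝ] ℝ} (h₁ : f₁ v₀ = 1) (h₂ : f₂ v₀ = 1) {R₁ R₂ : ℝ} (hR₁ : 0 < R₁)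
    (hR₂ : 0 < R₂) (hf₁ : ∀ v ∈ C, ‖v‖ ≤ R₁ * f₁ v) (hf₂ : ∀ v ∈ C, ‖v‖ ≤ R₂ * f₂ v)
    (hc₁ : ∀ g : E →L[ℝ] ℝ, g v₀ = 0 → ∫ v in C, g v * Real.exp (-f₁ v) ∂μ = 0)
    (hc₂ : ∀ g : E →L[ℝ] ℝ, g v₀ = 0 → ∫ v in C, g v * Real.exp (-f₂ v) ∂μ = 0) :
    f₁ = f₂ := by
  set G : E → ℝ := fun v => (f₁ - f₂) v * Real.exp (-f₂ v) - (f₁ - f₂) v * Real.exp (-f₁ v)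
    with hG
  have hG0 : ∀ v, 0 ≤ G v := by
    intro v
    simp only [hG, sub_apply]
    rcases le_total (f₁ v) (f₂ v) with h | h
    · have := Real.exp_le_exp.2 (neg_le_neg h)
      nlinarith
    · have := Real.exp_le_exp.2 (neg_le_neg h)
      nlinarith
  have hint := (integrableOn_mul_exp_neg μ hO hR₂ hf₂ (f₁ - f₂)).sub
    (integrableOn_mul_exp_neg μ hO hR₁ hf₁ (f₁ - f₂))
  have hz : ∫ v in C, G v ∂μ = 0 := by
    have hv : (f₁ - f₂) v₀ = 0 := by simp [h₁, h₂]
    rw [hG, integral_sub (integrableOn_mul_exp_neg μ hO hR₂ hf₂ (f₁ - f₂))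
      (integrableOn_mul_exp_neg μ hO hR₁ hf₁ (f₁ - f₂)), hc₁ _ hv, hc₂ _ hv, sub_zero]
  have hae : G =ᵐ[μ.restrict C] 0 := (integral_eq_zero_iff_of_nonneg hG0 hint).1 hz
  have heq : EqOn G 0 C := Measure.eqOn_open_of_ae_eq hae hO
    (by fun_prop) continuousOn_const
  have hd : ∀ v ∈ C, (f₁ - f₂) v = 0 := by
    intro v hv
    have h : (f₁ - f₂) v * (Real.exp (-f₂ v) - Real.exp (-f₁ v)) = 0 := by
      rw [mul_sub]; exact heq hv
    rcases mul_eq_zero.1 h with h | h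
    · exact h
    · have := Real.exp_injective (sub_eq_zero.1 h)
      simp only [sub_apply]
      linarith
  have hder : HasFDerivAt (f₁ - f₂) (0 : E →L[ℝ] ℝ) v₀ :=
    (hasFDerivAt_const (0 : ℝ) v₀).congr_of_eventuallyEq
      (eventually_of_mem (hO.mem_nhds hv₀) hd)
  exact sub_eq_zero.1 ((f₁ - f₂).hasFDerivAt.unique hder)

end Integrals

section AffineSlice

variable {E P : Type*} [NormedAddCommGroup E] [NormedSpace ℝ E] [FiniteDimensional ℝ E]
  [MeasurableSpace E] [BorelSpace E] (μ : Measure E) [μ.IsAddHaarMeasure]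
  [NormedAddCommGroup P] [NormedSpace ℝ P] [FiniteDimensional ℝ P]
  [MeasurableSpace P] [BorelSpace P] (ν : Measure P) [ν.IsAddHaarMeasure]
  {C : Set E}

omit [FiniteDimensional ℝ E] [MeasurableSpace E] [BorelSpace E] [FiniteDimensional ℝ P]
  [MeasurableSpace P] [BorelSpace P] in
/-- An affine parametrization `A` of the hyperplane `{f = 1}` extends to a linear coordinate system
`(s, p) ↦ s • A 0 + A.linear p` of the whole space. -/
theorem exists_linearEquiv_of_affine_slice {f : E →L[ℝ] ℝ} {A : P →ᵃ[ℝ] E}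
    (hA : Function.Injective A) (hr : range A = {v | f v = 1}) :
    ∃ M : (ℝ × P) ≃ₗ[ℝ] E, ∀ s p, M (s, p) = s • A 0 + A.linear p := by
  have hA1 : ∀ p, f (A p) = 1 := fun p => by
    have h : A p ∈ range A := mem_range_self p
    rwa [hr] at h
  have hdec : ∀ p, A p = A.linear p + A 0 := fun p => congrFun A.decomp p
  have hL : ∀ p, f (A.linear p) = 0 := fun p => by
    have h := hA1 p
    rw [hdec, map_add, hA1] at h
    linarith
  set M : (ℝ × P) →ₗ[ℝ] E :=
    (LinearMap.fst ℝ ℝ P).smulRight (A 0) + A.linear ∘ₗ LinearMap.snd ℝ ℝ P with hM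
  have hMap : ∀ s p, M (s, p) = s • A 0 + A.linear p := fun s p => rfl
  have hinj : Function.Injective M := by
    rw [injective_iff_map_eq_zero]
    rintro ⟨s, p⟩ h
    rw [hMap] at h
    have hs : s = 0 := by simpa [hA1, hL] using congrArg f h
    subst hs
    rw [zero_smul, zero_add, ← map_zero A.linear] at h
    rw [A.linear_injective_iff.2 hA h]
    rfl
  have hsurj : Function.Surjective M := by
    intro v
    have h : v - (f v - 1) • A 0 ∈ range A := by
      rw [hr, mem_ofPred_eq, map_sub, map_smul, hA1]
      simp
    obtain ⟨p, hp⟩ := h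
    refine ⟨(f v, p), ?_⟩
    rw [hMap]
    rw [hdec] at hp
    rw [eq_sub_of_add_eq hp]
    module
  exact ⟨LinearEquiv.ofBijective M ⟨hinj, hsurj⟩, hMap⟩

/-- Integrating a linear functional against `exp (-f)` over a cone amounts, up to a constant, to
integrating it over the slice `{f = 1}`. -/
theorem exists_integral_cone_eq_integral_slice (hO : IsOpen C)
    (hs : ∀ c : ℝ, 0 < c → ∀ v ∈ C, c • v ∈ C) (h0 : (0 : E) ∉ C) {f : E →L[ℝ] ℝ} {R : ℝ}
    (hR : 0 < R) (hf : ∀ v ∈ C, ‖v‖ ≤ R * f v) {A : P →ᵃ[ℝ] E}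
    (hA : Function.Injective A) (hr : range A = {v | f v = 1}) :
    ∃ c : ℝ, c ≠ 0 ∧ ∀ g : E →L[ℝ] ℝ,
      ∫ v in C, g v * Real.exp (-f v) ∂μ = c * ∫ p in A ⁻¹' C, g (A p) ∂ν := by
  have hA1 : ∀ p, f (A p) = 1 := fun p => by
    have h : A p ∈ range A := mem_range_self p
    rwa [hr] at h
  have hdec : ∀ p, A p = A.linear p + A 0 := fun p => congrFun A.decomp p
  have hpos : ∀ v ∈ C, 0 < f v := fun v hv =>
    pos_of_mul_pos_right ((norm_pos_iff.2 (ne_of_mem_of_not_mem hv h0)).trans_le (hf v hv)) hR.le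
  have hsiff : ∀ c : ℝ, 0 < c → ∀ v, c • v ∈ C ↔ v ∈ C := fun c hc v =>
    ⟨fun h => by simpa [smul_smul, hc.ne'] using hs c⁻¹ (inv_pos.2 hc) _ h, hs c hc v⟩
  have hO' : IsOpen (A ⁻¹' C) := hO.preimage A.continuous_of_finiteDimensional
  obtain ⟨M, hM⟩ := exists_linearEquiv_of_affine_slice hA hr
  have hfM : ∀ s p, f (M (s, p)) = s := fun s p => by
    have h := hA1 p
    rw [hdec, map_add, hA1] at h
    rw [hM, map_add, map_smul, hA1, smul_eq_mul]
    linarith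
  set e := M.toContinuousLinearEquiv with he
  have heM : ∀ z, e z = M z := fun z => rfl
  have hmap : ((volume : Measure ℝ).prod ν).map e
      = Measure.addHaarScalarFactor (((volume : Measure ℝ).prod ν).map e) μ • μ :=
    Measure.isAddLeftInvariant_eq_smul _ _
  have hk : 0 < Measure.addHaarScalarFactor (((volume : Measure ℝ).prod ν).map e) μ :=
    Measure.addHaarScalarFactor_pos_of_isAddHaarMeasure _ _
  set k := Measure.addHaarScalarFactor (((volume : Measure ℝ).prod ν).map e) μ
  set d := Module.finrank ℝ P
  have hΓ : 0 < ∫ s : ℝ, (Ioi (0 : ℝ)).indicator (fun s => s ^ (d + 1) * Real.exp (-s)) s := by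
    rw [integral_indicator measurableSet_Ioi]
    have h := Real.Gamma_eq_integral (s := d + 2) (by positivity)
    have h' : ∫ s in Ioi (0 : ℝ), s ^ (d + 1) * Real.exp (-s) = Real.Gamma (d + 2) := by
      rw [h]
      refine setIntegral_congr_fun measurableSet_Ioi fun s hs => ?_
      have : (d : ℝ) + 2 - 1 = ((d + 1 : ℕ) : ℝ) := by push_cast; ring
      rw [this, Real.rpow_natCast, mul_comm]
    rw [h']
    exact Real.Gamma_pos_of_pos (by positivity)
  set Γ := ∫ s : ℝ, (Ioi (0 : ℝ)).indicator (fun s => s ^ (d + 1) * Real.exp (-s)) s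
  refine ⟨(k : ℝ)⁻¹ * Γ, by positivity, fun g => ?_⟩
  set G : E → ℝ := C.indicator fun v => g v * Real.exp (-f v) with hG
  have hGint : Integrable G μ :=
    (integrableOn_mul_exp_neg μ hO hR hf g).integrable_indicator hO.measurableSet
  have hemb : MeasurableEmbedding e := e.toHomeomorph.measurableEmbedding
  have hGint' : Integrable (fun z => G (e z)) ((volume : Measure ℝ).prod ν) := by
    have h : Integrable G (((volume : Measure ℝ).prod ν).map e) := by
      rw [hmap]
      exact hGint.smul_measure_nnreal
    exact (hemb.integrable_map_iff).1 h
  have hslice : ∀ s : ℝ, ∫ q, G (e (s, q)) ∂ν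
      = (Ioi (0 : ℝ)).indicator (fun s => s ^ (d + 1) * Real.exp (-s)) s
        * ∫ p in A ⁻¹' C, g (A p) ∂ν := by
    intro s
    rcases le_or_gt s 0 with hs0 | hs0
    · rw [indicator_of_notMem (by simpa using hs0), zero_mul]
      refine integral_eq_zero_of_ae (Eventually.of_forall fun q => ?_)
      refine indicator_of_notMem (fun hmem => ?_) _
      have := hpos _ hmem
      rw [heM, hfM] at this
      linarith
    · rw [indicator_of_mem (by simpa using hs0)]
      have h := Measure.integral_comp_smul_of_nonneg ν (fun q => G (e (s, q))) s (hR := hs0.le)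
      have h' : ∀ p, G (e (s, s • p))
          = s * Real.exp (-s) * (A ⁻¹' C).indicator (fun p => g (A p)) p := by
        intro p
        have hep : e (s, s • p) = s • A p := by
          rw [heM, hM, map_smul, hdec p, smul_add, add_comm]
        rw [hep]
        by_cases hp : A p ∈ C
        · rw [hG, indicator_of_mem ((hsiff s hs0 _).2 hp),
            indicator_of_mem (show p ∈ A ⁻¹' C from hp), map_smul, map_smul, hA1]
          simp only [smul_eq_mul, mul_one]
          ring
        · rw [hG, indicator_of_notMem (fun hc => hp ((hsiff s hs0 _).1 hc)),
            indicator_of_notMem (show p ∉ A ⁻¹' C from hp), mul_zero]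
      simp only [h'] at h
      rw [integral_const_mul, integral_indicator hO'.measurableSet, smul_eq_mul,
        inv_mul_eq_div, eq_div_iff (by positivity)] at h
      rw [← h]
      ring
  have hfinal : (k : ℝ) * ∫ v, G v ∂μ = Γ * ∫ p in A ⁻¹' C, g (A p) ∂ν := by
    have h : ∫ v, G v ∂(((volume : Measure ℝ).prod ν).map e) = k • ∫ v, G v ∂μ := by
      rw [← integral_smul_nnreal_measure, ← hmap]
    rw [← smul_eq_mul, ← NNReal.smul_def, ← h, hemb.integral_map, integral_prod _ hGint']
    simp only [hslice]
    rw [integral_mul_const]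
  rw [← integral_indicator hO.measurableSet, mul_assoc, ← hfinal, inv_mul_cancel_left₀]
  exact_mod_cast hk.ne'

omit [MeasurableSpace E] [BorelSpace E] in
theorem apply_setAverage_slice {f : E →L[ℝ] ℝ} {R : ℝ} (hO : IsOpen C)
    (hf : ∀ v ∈ C, ‖v‖ ≤ R * f v) {A : P →ᵃ[ℝ] E}
    (hA : Function.Injective A) (hr : range A = {v | f v = 1}) (hne : (A ⁻¹' C).Nonempty) :
    ν.real (A ⁻¹' C) ≠ 0 ∧ ∀ g : E →L[ℝ] ℝ,
      ∫ p in A ⁻¹' C, g (A p) ∂ν = ν.real (A ⁻¹' C) * g (A (⨍ p in A ⁻¹' C, p ∂ν)) := by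
  have hA1 : ∀ p, f (A p) = 1 := fun p => by
    have h : A p ∈ range A := mem_range_self p
    rwa [hr] at h
  have hdec : ∀ p, A p = A.linear p + A 0 := fun p => congrFun A.decomp p
  have hO' : IsOpen (A ⁻¹' C) := hO.preimage A.continuous_of_finiteDimensional
  obtain ⟨M, hM⟩ := exists_linearEquiv_of_affine_slice hA hr
  set B : E →L[ℝ] P :=
    (ContinuousLinearMap.snd ℝ ℝ P).comp (M.symm.toContinuousLinearEquiv : E →L[ℝ] ℝ × P) with hB
  have hBA : ∀ p, B (A p) = p := fun p => by
    have h : A p = M (1, p) := by rw [hM, one_smul, hdec p, add_comm]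
    rw [h]
    simp [hB]
  have hbd : ∀ p ∈ A ⁻¹' C, ‖p‖ ≤ ‖B‖ * R := fun p hp => by
    have h := hf _ hp
    rw [hA1, mul_one] at h
    calc ‖p‖ = ‖B (A p)‖ := by rw [hBA]
      _ ≤ ‖B‖ * ‖A p‖ := B.le_opNorm _
      _ ≤ _ := by gcongr
  have hfin : ν (A ⁻¹' C) < ⊤ :=
    (isBounded_iff_forall_norm_le.2 ⟨_, hbd⟩).measure_lt_top
  have hreal : ν.real (A ⁻¹' C) ≠ 0 :=
    (ENNReal.toReal_pos (hO'.measure_pos ν hne).ne' hfin.ne).ne'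
  have hint : IntegrableOn (fun p : P => p) (A ⁻¹' C) ν :=
    Measure.integrableOn_of_bounded hfin.ne (by fun_prop)
      (ae_restrict_of_forall_mem hO'.measurableSet hbd)
  refine ⟨hreal, fun g => ?_⟩
  set L : P →L[ℝ] ℝ := g.comp (LinearMap.toContinuousLinearMap A.linear) with hL
  have hgA : ∀ p, g (A p) = L p + g (A 0) := fun p => by rw [hdec p, map_add]; rfl
  have hconst : IntegrableOn (fun _ : P => g (A 0)) (A ⁻¹' C) ν := integrableOn_const hfin.ne
  rw [hgA (⨍ p in A ⁻¹' C, p ∂ν), funext hgA,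
    integral_add (L.integrable_comp hint) hconst, L.integral_comp_comm hint, setAverage_eq,
    map_smul, setIntegral_const, smul_eq_mul, smul_eq_mul, mul_add, mul_inv_cancel_left₀ hreal]

/-- The center of mass of the slice `{f = 1}` of a cone is `v₀` if and only if `f` is critical for
the characteristic function of the cone among functionals with `f v₀ = 1`. -/
theorem affine_setAverage_eq_iff (hO : IsOpen C)
    (hs : ∀ c : ℝ, 0 < c → ∀ v ∈ C, c • v ∈ C) (h0 : (0 : E) ∉ C) {f : E →L[ℝ] ℝ} {R : ℝ}
    (hR : 0 < R) (hf : ∀ v ∈ C, ‖v‖ ≤ R * f v) {A : P →ᵃ[ℝ] E}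
    (hA : Function.Injective A) (hr : range A = {v | f v = 1}) {v₀ : E} (hv₀ : v₀ ∈ C)
    (hfv₀ : f v₀ = 1) :
    A (⨍ p in A ⁻¹' C, p ∂ν) = v₀ ↔
      ∀ g : E →L[ℝ] ℝ, g v₀ = 0 → ∫ v in C, g v * Real.exp (-f v) ∂μ = 0 := by
  obtain ⟨p₀, hp₀⟩ : v₀ ∈ range A := hr ▸ hfv₀
  obtain ⟨hreal, havg⟩ := apply_setAverage_slice ν hO hf hA hr ⟨p₀, by simpa [hp₀] using hv₀⟩
  obtain ⟨c, hc, hint⟩ := exists_integral_cone_eq_integral_slice μ ν hO hs h0 hR hf hA hr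
  set w := A (⨍ p in A ⁻¹' C, p ∂ν) with hw
  have hfw : f w = 1 := by
    have h : w ∈ range A := mem_range_self _
    rwa [hr] at h
  constructor
  · intro h g hg
    rw [hint, havg, h, hg, mul_zero, mul_zero]
  · intro h
    refine (SeparatingDual.eq_iff_forall_dual_eq (R := ℝ)).2 fun φ => ?_
    have h1 := h (φ - φ v₀ • f) (by simp [hfv₀])
    rw [hint, havg] at h1
    simpa [hc, hreal, hfw, sub_eq_zero] using h1

end AffineSlice

section Projective

variable {n : ℕ} {C : Set (Fin (n + 1) → ℝ)}

theorem dehom_mk (f : (Fin (n + 1) → ℝ) →ₗ[ℝ] ℝ) (v : Fin (n + 1) → ℝ) (hv : v ≠ 0) :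
    dehom f (Projectivization.mk ℝ v hv) = (f v)⁻¹ • v := by
  obtain ⟨a, ha⟩ := Projectivization.exists_smul_eq_mk_rep ℝ v hv
  have ha0 : (a : ℝ) ≠ 0 := a.ne_zero
  rw [dehom, ← ha, Units.smul_def, map_smul, smul_eq_mul, smul_smul, mul_inv, mul_right_comm,
    inv_mul_cancel₀ ha0, one_mul]

theorem mk_mem_chart_iff (f : (Fin (n + 1) → ℝ) →ₗ[ℝ] ℝ) (v : Fin (n + 1) → ℝ) (hv : v ≠ 0) :
    Projectivization.mk ℝ v hv ∈ chart f ↔ f v ≠ 0 := by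
  obtain ⟨a, ha⟩ := Projectivization.exists_smul_eq_mk_rep ℝ v hv
  have ha0 : (a : ℝ) ≠ 0 := a.ne_zero
  change f _ ≠ 0 ↔ _
  rw [← ha, Units.smul_def, map_smul, smul_eq_mul]
  simp [ha0]

theorem dehom_image_projOf (hs : ∀ c : ℝ, 0 < c → ∀ v ∈ C, c • v ∈ C)
    (h0 : (0 : Fin (n + 1) → ℝ) ∉ C) {f : (Fin (n + 1) → ℝ) →ₗ[ℝ] ℝ} (hf : ∀ v ∈ C, 0 < f v) :
    dehom f '' projOf C = C ∩ {v | f v = 1} := by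
  ext w
  constructor
  · rintro ⟨_, ⟨v, hv0, hv, rfl⟩, rfl⟩
    rw [dehom_mk]
    exact ⟨hs _ (inv_pos.2 (hf v hv)) v hv, by simp [(hf v hv).ne']⟩
  · rintro ⟨hw, hw1⟩
    have hw0 : w ≠ 0 := ne_of_mem_of_not_mem hw h0
    refine ⟨_, ⟨w, hw0, hw, rfl⟩, ?_⟩
    rw [dehom_mk, (hw1 : f w = 1), inv_one, one_smul]

open scoped Pointwise in
theorem IsBoundedWithBarycenter.smul {f : (Fin (n + 1) → ℝ) →ₗ[ℝ] ℝ}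
    {Ω : Set (Projectivization ℝ (Fin (n + 1) → ℝ))}
    {x : Projectivization ℝ (Fin (n + 1) → ℝ)} (h : IsBoundedWithBarycenter f Ω x) {c : ℝ}
    (hc : c ≠ 0) : IsBoundedWithBarycenter (c • f) Ω x := by
  obtain ⟨hch, hbd, hbar⟩ := h
  have hde : ∀ y, dehom (c • f) y = c⁻¹ • dehom f y := fun y => by
    simp only [dehom, LinearMap.smul_apply, smul_eq_mul, mul_inv, smul_smul]
  have him : dehom (c • f) '' Ω = c⁻¹ • dehom f '' Ω := by
    rw [← image_smul, image_image]
    exact image_congr fun y _ => hde y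
  refine ⟨fun y hy => ?_, ?_, fun A hA hr => ?_⟩
  · exact mul_ne_zero hc (hch hy)
  · rw [him]
    exact hbd.smul₀ _
  · have hpre : (c • A) ⁻¹' (dehom f '' Ω) = A ⁻¹' (dehom (c • f) '' Ω) := by
      ext p
      rw [him, mem_preimage, mem_preimage, mem_inv_smul_set_iff₀ hc]
      rfl
    have hr' : range (c • A) = {v | f v = 1} := by
      ext v
      have hv : c⁻¹ • v ∈ range A ↔ f v = 1 := by
        rw [hr, mem_ofPred_eq, LinearMap.smul_apply, map_smul, smul_smul, mul_inv_cancel₀ hc,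
          one_smul]
      rw [mem_ofPred_eq, ← hv]
      simp only [mem_range, AffineMap.coe_smul, Pi.smul_apply]
      exact exists_congr fun p => (eq_inv_smul_iff₀ hc).symm
    have hinj : Function.Injective (c • A) := fun p q hpq => hA (smul_right_injective _ hc hpq)
    have h := hbar (c • A) hinj hr'
    rw [hpre] at h
    rw [hde, ← h, AffineMap.coe_smul, Pi.smul_apply, smul_smul, inv_mul_cancel₀ hc, one_smul]

theorem exists_affine_parametrization (f : (Fin (n + 1) → ℝ) →ₗ[ℝ] ℝ) {v₀ : Fin (n + 1) → ℝ}
    (hv₀ : f v₀ = 1) : ∃ A : (Fin n → ℝ) →ᵃ[ℝ] (Fin (n + 1) → ℝ),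
      Function.Injective A ∧ range A = {v | f v = 1} := by
  have hf : f ≠ 0 := by
    rintro rfl
    simp at hv₀
  have hrank : Module.finrank ℝ (Fin n → ℝ) = Module.finrank ℝ (LinearMap.ker f) := by
    have h := Module.Dual.finrank_ker_add_one_of_ne_zero (f := f) hf
    rw [Module.finrank_fin_fun] at h ⊢
    omega
  let φ := LinearEquiv.ofFinrankEq _ _ hrank
  let A : (Fin n → ℝ) →ᵃ[ℝ] (Fin (n + 1) → ℝ) :=
    ((LinearMap.ker f).subtype ∘ₗ φ.toLinearMap).toAffineMap + AffineMap.const ℝ _ v₀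
  have hA : ∀ p, A p = (φ p : Fin (n + 1) → ℝ) + v₀ := fun p => rfl
  refine ⟨A, fun p q h => ?_, ?_⟩
  · rw [hA, hA] at h
    exact φ.injective (Subtype.ext (add_right_cancel h))
  · ext v
    constructor
    · rintro ⟨p, rfl⟩
      rw [hA, mem_ofPred_eq, map_add, hv₀, LinearMap.mem_ker.1 (φ p).2, zero_add]
    · intro hv
      have hker : v - v₀ ∈ LinearMap.ker f := by
        rw [LinearMap.mem_ker, map_sub, hv₀, (hv : f v = 1), sub_self]
      exact ⟨φ.symm ⟨_, hker⟩, by simp [hA]⟩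

/-- For a functional normalized by `f v₀ = 1`, being bounded with center of mass `[v₀]` means
dominating the norm on the cone and being critical for its characteristic function. -/
theorem isBoundedWithBarycenter_iff (hC : IsPCone C) {v₀ : Fin (n + 1) → ℝ} (hv₀ : v₀ ∈ C)
    (hv₀0 : v₀ ≠ 0) (f : (Fin (n + 1) → ℝ) →L[ℝ] ℝ) (hfv₀ : f v₀ = 1) :
    IsBoundedWithBarycenter (f : (Fin (n + 1) → ℝ) →ₗ[ℝ] ℝ) (projOf C)
        (Projectivization.mk ℝ v₀ hv₀0) ↔
      (∃ R, 0 < R ∧ ∀ v ∈ C, ‖v‖ ≤ R * f v) ∧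
        ∀ g : (Fin (n + 1) → ℝ) →L[ℝ] ℝ, g v₀ = 0 → ∫ v in C, g v * Real.exp (-f v) = 0 := by
  obtain ⟨hO, hconv, -, h0, hs, -⟩ := hC
  have hdeh : dehom (f : (Fin (n + 1) → ℝ) →ₗ[ℝ] ℝ) (Projectivization.mk ℝ v₀ hv₀0) = v₀ := by
    rw [dehom_mk, ContinuousLinearMap.coe_coe, hfv₀, inv_one, one_smul]
  have hpre : ∀ A : (Fin n → ℝ) →ᵃ[ℝ] (Fin (n + 1) → ℝ), range A = {v | f v = 1} →
      (∀ v ∈ C, 0 < f v) →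
      A ⁻¹' (dehom (f : (Fin (n + 1) → ℝ) →ₗ[ℝ] ℝ) '' projOf C) = A ⁻¹' C := by
    intro A hr hf
    rw [dehom_image_projOf hs h0 hf, preimage_inter]
    refine inter_eq_left.2 fun p _ => ?_
    have h : A p ∈ range A := mem_range_self p
    rwa [hr] at h
  constructor
  · rintro ⟨hch, hbd, hbar⟩
    have hne : ∀ v ∈ C, f v ≠ 0 := fun v hv =>
      (mk_mem_chart_iff _ v (ne_of_mem_of_not_mem hv h0)).1 (hch ⟨v, _, hv, rfl⟩)
    have hpos : ∀ v ∈ C, 0 < f v := by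
      intro v hv
      by_contra! hle
      obtain ⟨w, hw, hw0⟩ := hconv.isPreconnected.intermediate_value hv hv₀
        f.continuous.continuousOn ⟨hle, hfv₀.symm ▸ zero_le_one⟩
      exact hne w hw hw0
    have hbound : ∃ R, 0 < R ∧ ∀ v ∈ C, ‖v‖ ≤ R * f v := by
      obtain ⟨R, hR, hRb⟩ := hbd.exists_pos_norm_le
      refine ⟨R, hR, fun v hv => ?_⟩
      have hfv := hpos v hv
      have h := hRb ((f v)⁻¹ • v) (by
        rw [dehom_image_projOf hs h0 hpos]
        exact ⟨hs _ (inv_pos.2 hfv) v hv, by simp [hfv.ne']⟩)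
      rwa [norm_smul, norm_inv, Real.norm_of_nonneg hfv.le, inv_mul_le_iff₀ hfv, mul_comm] at h
    refine ⟨hbound, ?_⟩
    obtain ⟨R, hR, hRf⟩ := hbound
    obtain ⟨A, hA, hr⟩ := exists_affine_parametrization (f : (Fin (n + 1) → ℝ) →ₗ[ℝ] ℝ) hfv₀
    have h := hbar A hA hr
    rw [hdeh, hpre A hr hpos] at h
    exact (affine_setAverage_eq_iff volume volume hO hs h0 hR hRf hA hr hv₀ hfv₀).1 h
  · rintro ⟨⟨R, hR, hRf⟩, hcrit⟩
    have hpos : ∀ v ∈ C, 0 < f v := fun v hv => pos_of_mul_pos_right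
      ((norm_pos_iff.2 (ne_of_mem_of_not_mem hv h0)).trans_le (hRf v hv)) hR.le
    refine ⟨?_, ?_, fun A hA hr => ?_⟩
    · rintro _ ⟨v, hv0, hv, rfl⟩
      exact (mk_mem_chart_iff _ v hv0).2 (hpos v hv).ne'
    · rw [dehom_image_projOf hs h0 hpos]
      refine isBounded_iff_forall_norm_le.2 ⟨R, fun v hv => ?_⟩
      have h := hRf v hv.1
      rwa [show f v = 1 from hv.2, mul_one] at h
    · rw [hdeh, hpre A hr hpos]
      exact (affine_setAverage_eq_iff volume volume hO hs h0 hR hRf hA hr hv₀ hfv₀).2 hcrit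

end Projective

/-- For every properly convex open set `Ω ⊆ ℙⁿ(ℝ)` and every `x ∈ Ω`,
there exists an affine chart, unique as a chart (i.e. the defining functional is unique up
to a nonzero scalar), in which `Ω` is bounded and `x` is the center of mass of `Ω`. -/
theorem stmt_11 (n : ℕ) (Ω : Set (Projectivization ℝ (Fin (n + 1) → ℝ)))
    (hΩ : IsProperlyConvexOpen Ω) (x : Projectivization ℝ (Fin (n + 1) → ℝ)) (hx : x ∈ Ω) :
    (∃ f : (Fin (n + 1) → ℝ) →ₗ[ℝ] ℝ, f ≠ 0 ∧ IsBoundedWithBarycenter f Ω x) ∧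
    ∀ f₁ f₂ : (Fin (n + 1) → ℝ) →ₗ[ℝ] ℝ, f₁ ≠ 0 → f₂ ≠ 0 →
      IsBoundedWithBarycenter f₁ Ω x → IsBoundedWithBarycenter f₂ Ω x →
      ∃ c : ℝ, c ≠ 0 ∧ f₂ = c • f₁ := by
  obtain ⟨C, hC, rfl⟩ := hΩ
  obtain ⟨v₀, hv₀0, hv₀, rfl⟩ := hx
  refine ⟨?_, fun f₁ f₂ _ _ h₁ h₂ => ?_⟩
  · obtain ⟨hO, hconv, -, h0, hs, hsal⟩ := id hC
    obtain ⟨f, hf1, hR, hcrit⟩ := exists_critical_functional volume hO hconv hs h0 hsal hv₀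
    refine ⟨f, fun h => ?_, (isBoundedWithBarycenter_iff hC hv₀ hv₀0 f hf1).2 ⟨hR, hcrit⟩⟩
    have h' : f v₀ = 0 := LinearMap.congr_fun h v₀
    exact one_ne_zero (hf1.symm.trans h')
  · have hnormal : ∀ f : (Fin (n + 1) → ℝ) →ₗ[ℝ] ℝ,
        IsBoundedWithBarycenter f (projOf C) (Projectivization.mk ℝ v₀ hv₀0) →
        f v₀ ≠ 0 ∧ ∃ F : (Fin (n + 1) → ℝ) →L[ℝ] ℝ, F v₀ = 1 ∧
          (F : (Fin (n + 1) → ℝ) →ₗ[ℝ] ℝ) = (f v₀)⁻¹ • f ∧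
          IsBoundedWithBarycenter (F : (Fin (n + 1) → ℝ) →ₗ[ℝ] ℝ) (projOf C)
            (Projectivization.mk ℝ v₀ hv₀0) := by
      intro f hf
      have hf0 : f v₀ ≠ 0 := (mk_mem_chart_iff f v₀ hv₀0).1 (hf.1 ⟨v₀, hv₀0, hv₀, rfl⟩)
      refine ⟨hf0, LinearMap.toContinuousLinearMap ((f v₀)⁻¹ • f), ?_, rfl, ?_⟩
      · simp [hf0]
      · exact hf.smul (inv_ne_zero hf0)
    obtain ⟨hn₁, F₁, hF₁, hFf₁, hB₁⟩ := hnormal f₁ h₁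
    obtain ⟨hn₂, F₂, hF₂, hFf₂, hB₂⟩ := hnormal f₂ h₂
    obtain ⟨⟨R₁, hR₁, hRF₁⟩, hc₁⟩ := (isBoundedWithBarycenter_iff hC hv₀ hv₀0 F₁ hF₁).1 hB₁
    obtain ⟨⟨R₂, hR₂, hRF₂⟩, hc₂⟩ := (isBoundedWithBarycenter_iff hC hv₀ hv₀0 F₂ hF₂).1 hB₂
    have heq : F₁ = F₂ :=
      critical_functional_unique volume hC.1 hv₀ hF₁ hF₂ hR₁ hR₂ hRF₁ hRF₂ hc₁ hc₂
    refine ⟨f₂ v₀ * (f₁ v₀)⁻¹, mul_ne_zero hn₂ (inv_ne_zero hn₁), ?_⟩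
    rw [mul_smul, ← hFf₁, heq, hFf₂, smul_smul, mul_inv_cancel₀ hn₂, one_smul]
end

section
/- The set ℰ_s of standard marked convex bodies (Ω, O)—where Ω is a bounded open convex subset of ℝⁿ with barycenter O = 0 and inertia ellipsoid equal to the unit ball—is compact for the Hausdorff topology on closed subsets, and sits between the balls B(O, r_n) and B(O, R_n). -/
open MeasureTheory Metric

/-- A standard (marked) convex body: a bounded open convex subset of Euclidean `ℝⁿ` with
center of mass the origin and inertia ellipsoid the unit ball. -/
def IsStdBody (n : ℕ) (Ω : Set (EuclideanSpace ℝ (Fin n))) : Prop :=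
  IsOpen Ω ∧ Convex ℝ Ω ∧ Bornology.IsBounded Ω ∧ Ω.Nonempty ∧
    (∫ x in Ω, x = 0) ∧
    ∀ ψ : EuclideanSpace ℝ (Fin n) →ₗ[ℝ] ℝ,
      ∫ x in Ω, (ψ x) ^ 2 = ∫ x in ball (0 : EuclideanSpace ℝ (Fin n)) 1, (ψ x) ^ 2

open Set Filter Topology
open scoped RealInnerProductSpace

section Bounded

variable {n : ℕ} {Ω : Set (EuclideanSpace ℝ (Fin n))}

lemma Continuous.integrableOn_of_isBounded {F : Type*} [NormedAddCommGroup F]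
    {f : EuclideanSpace ℝ (Fin n) → F} (hf : Continuous f) (hΩ : Bornology.IsBounded Ω) :
    IntegrableOn f Ω :=
  (hf.continuousOn.integrableOn_compact hΩ.isCompact_closure).mono_set subset_closure

lemma exists_pos_mul_sq_norm_le_integral_ball (n : ℕ) :
    ∃ c : ℝ, 0 < c ∧ ∀ y : EuclideanSpace ℝ (Fin n),
      c * ‖y‖ ^ 2 ≤ ∫ x in ball (0 : EuclideanSpace ℝ (Fin n)) 1, ⟪y, x⟫ ^ 2 := by
  set v := volume.real (ball (0 : EuclideanSpace ℝ (Fin n)) (1 / 4)) with hv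
  have hv0 : 0 < v := ENNReal.toReal_pos (measure_ball_pos _ _ (by norm_num)).ne'
    measure_ball_lt_top.ne
  refine ⟨v / 16, by positivity, fun y => ?_⟩
  rcases eq_or_ne y 0 with rfl | hy
  · simp
  have hy0 : 0 < ‖y‖ := norm_pos_iff.2 hy
  set p : EuclideanSpace ℝ (Fin n) := (1 / (2 * ‖y‖)) • y with hp
  have hpn : ‖p‖ = 1 / 2 := by
    rw [hp, norm_smul, Real.norm_of_nonneg (by positivity)]; field_simp
  have hpy : ⟪y, p⟫ = ‖y‖ / 2 := by
    rw [hp, inner_smul_right, real_inner_self_eq_norm_sq]; field_simp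
  have hvp : volume.real (ball p (1 / 4)) = v := by
    simp [hv, Measure.real, Measure.addHaar_ball_center]
  have hcont : Continuous fun x : EuclideanSpace ℝ (Fin n) => ⟪y, x⟫ ^ 2 := by fun_prop
  calc v / 16 * ‖y‖ ^ 2 = (‖y‖ / 4) ^ 2 * volume.real (ball p (1 / 4)) := by rw [hvp]; ring
    _ ≤ ∫ x in ball p (1 / 4), ⟪y, x⟫ ^ 2 := by
        refine setIntegral_ge_of_const_le_real measurableSet_ball measure_ball_lt_top.ne ?_
          (hcont.integrableOn_of_isBounded isBounded_ball)
        intro x hx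
        have h1 : |⟪y, x - p⟫| ≤ ‖y‖ * ‖x - p‖ := abs_real_inner_le_norm _ _
        have h2 : ‖x - p‖ < 1 / 4 := by simpa [dist_eq_norm] using hx
        rw [inner_sub_right, hpy] at h1
        have h3 := abs_le.1 h1
        gcongr
        nlinarith [h3.1]
    _ ≤ _ := by
        refine setIntegral_mono_set (hcont.integrableOn_of_isBounded isBounded_ball)
          (ae_of_all _ fun x => sq_nonneg _) (LE.le.eventuallyLE ?_)
        refine ball_subset_ball' ?_
        rw [dist_zero_right, hpn]; norm_num

lemma integral_ball_sq_inner_le (y : EuclideanSpace ℝ (Fin n)) :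
    ∫ x in ball (0 : EuclideanSpace ℝ (Fin n)) 1, ⟪y, x⟫ ^ 2 ≤
      volume.real (ball (0 : EuclideanSpace ℝ (Fin n)) 1) * ‖y‖ ^ 2 := by
  have hcont : Continuous fun x : EuclideanSpace ℝ (Fin n) => ⟪y, x⟫ ^ 2 := by fun_prop
  rw [← smul_eq_mul, ← setIntegral_const]
  refine setIntegral_mono_on (hcont.integrableOn_of_isBounded isBounded_ball)
    (integrableOn_const measure_ball_lt_top.ne) measurableSet_ball fun x hx => ?_
  rw [← sq_abs]
  have h1 : |⟪y, x⟫| ≤ ‖y‖ * ‖x‖ := abs_real_inner_le_norm _ _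
  have h2 : ‖x‖ < 1 := by simpa using hx
  gcongr
  nlinarith [norm_nonneg y]

end Bounded

namespace IsStdBody

variable {n : ℕ} {Ω : Set (EuclideanSpace ℝ (Fin n))}

lemma integral_sq_inner (h : IsStdBody n Ω) (y : EuclideanSpace ℝ (Fin n)) :
    ∫ x in Ω, ⟪y, x⟫ ^ 2 = ∫ x in ball (0 : EuclideanSpace ℝ (Fin n)) 1, ⟪y, x⟫ ^ 2 := by
  simpa using h.2.2.2.2.2 (innerₛₗ ℝ y)

lemma integral_inner (h : IsStdBody n Ω) (y : EuclideanSpace ℝ (Fin n)) :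
    ∫ x in Ω, ⟪y, x⟫ = 0 := by
  have := _root_.integral_inner (𝕜 := ℝ) (μ := volume.restrict Ω) (f := fun x => x)
    (continuous_id.integrableOn_of_isBounded h.2.2.1) y
  rw [this, h.2.2.2.2.1, inner_zero_right]

lemma volume_lt_top (h : IsStdBody n Ω) : volume Ω < ⊤ := h.2.2.1.measure_lt_top

lemma volume_real_pos (h : IsStdBody n Ω) : 0 < volume.real Ω :=
  ENNReal.toReal_pos (h.1.measure_pos _ h.2.2.2.1).ne' h.volume_lt_top.ne

lemma sq_norm_mul_volume_le (h : IsStdBody n Ω) {p : EuclideanSpace ℝ (Fin n)} (hp : p ∈ Ω) :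
    ‖p‖ ^ 2 * volume.real Ω ≤
      2 ^ (n + 2) * volume.real (ball (0 : EuclideanSpace ℝ (Fin n)) 1) := by
  rcases eq_or_ne p 0 with rfl | hp0
  · rw [norm_zero, zero_pow two_ne_zero, zero_mul]; positivity
  have hpn : 0 < ‖p‖ := norm_pos_iff.2 hp0
  set q := ∫ x in Ω, ⟪p, x⟫ ^ 2 with hq
  have hcont : Continuous fun x : EuclideanSpace ℝ (Fin n) => ⟪p, x⟫ ^ 2 := by fun_prop
  have hqle : q ≤ volume.real (ball (0 : EuclideanSpace ℝ (Fin n)) 1) * ‖p‖ ^ 2 := by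
    rw [hq, h.integral_sq_inner]; exact integral_ball_sq_inner_le p
  set T : EuclideanSpace ℝ (Fin n) → EuclideanSpace ℝ (Fin n) :=
    fun x => (1 / 2 : ℝ) • x + (1 / 2 : ℝ) • p with hT
  have hTd : ∀ x ∈ Ω, HasFDerivWithinAt T
      ((1 / 2 : ℝ) • ContinuousLinearMap.id ℝ (EuclideanSpace ℝ (Fin n))) Ω x := fun x _ =>
    (((hasFDerivAt_id x).const_smul (1 / 2 : ℝ)).add_const _).hasFDerivWithinAt
  have hTi : InjOn T Ω := fun x _ y _ hxy => by simpa [hT] using hxy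
  have hsub : T '' Ω ⊆ Ω := by
    rintro _ ⟨x, hx, rfl⟩
    exact h.2.1 hx hp (by norm_num) (by norm_num) (by norm_num)
  have hdet : |((1 / 2 : ℝ) • ContinuousLinearMap.id ℝ (EuclideanSpace ℝ (Fin n))).det| =
      (1 / 2) ^ n := by
    rw [ContinuousLinearMap.det]
    simp [LinearMap.det_smul]
  have hcv := integral_image_eq_integral_abs_det_fderiv_smul volume h.1.measurableSet hTd hTi
    (fun x => ⟪p, x⟫ ^ 2)
  have hle : ∫ x in T '' Ω, ⟪p, x⟫ ^ 2 ≤ q :=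
    setIntegral_mono_set (hcont.integrableOn_of_isBounded h.2.2.1)
      (ae_of_all _ fun x => sq_nonneg _) hsub.eventuallyLE
  rw [hcv, hdet] at hle
  have hexp : ∫ x in Ω, (1 / 2 : ℝ) ^ n • ⟪p, T x⟫ ^ 2 =
      (1 / 2) ^ n * (1 / 4 * (q + volume.real Ω * (‖p‖ ^ 2) ^ 2)) := by
    have h1 : ∀ x, (1 / 2 : ℝ) ^ n • ⟪p, T x⟫ ^ 2 =
        (1 / 2) ^ n * (1 / 4 * ((⟪p, x⟫ ^ 2 + 2 * ‖p‖ ^ 2 * ⟪p, x⟫) + (‖p‖ ^ 2) ^ 2)) := by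
      intro x
      simp only [hT, inner_add_right, inner_smul_right, real_inner_self_eq_norm_sq, smul_eq_mul]
      ring
    have i1 : IntegrableOn (fun x => ⟪p, x⟫ ^ 2) Ω := hcont.integrableOn_of_isBounded h.2.2.1
    have i2 : IntegrableOn (fun x => 2 * ‖p‖ ^ 2 * ⟪p, x⟫) Ω :=
      Continuous.integrableOn_of_isBounded (by fun_prop) h.2.2.1
    have i3 : IntegrableOn (fun _ => (‖p‖ ^ 2) ^ 2) Ω :=
      Continuous.integrableOn_of_isBounded (by fun_prop) h.2.2.1
    have i12 : IntegrableOn (fun x => ⟪p, x⟫ ^ 2 + 2 * ‖p‖ ^ 2 * ⟪p, x⟫) Ω := i1.add i2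
    simp_rw [h1]
    rw [integral_const_mul, integral_const_mul, integral_add i12 i3, integral_add i1 i2,
      integral_const_mul, h.integral_inner, setIntegral_const, smul_eq_mul]
    ring
  rw [hexp] at hle
  have h2 : q + volume.real Ω * (‖p‖ ^ 2) ^ 2 ≤ 2 ^ (n + 2) * q := by
    have := mul_le_mul_of_nonneg_left hle (by positivity : (0 : ℝ) ≤ 2 ^ (n + 2))
    refine le_trans (le_of_eq ?_) this
    rw [one_div, inv_pow, pow_add]; field_simp; norm_num
  have hq0 : 0 ≤ q := integral_nonneg fun x => sq_nonneg _
  have h3 : ‖p‖ ^ 2 * (‖p‖ ^ 2 * volume.real Ω) ≤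
      ‖p‖ ^ 2 * (2 ^ (n + 2) * volume.real (ball (0 : EuclideanSpace ℝ (Fin n)) 1)) := by
    have := mul_le_mul_of_nonneg_left hqle (by positivity : (0 : ℝ) ≤ 2 ^ (n + 2))
    nlinarith
  exact le_of_mul_le_mul_left h3 (by positivity)

/-- A half-space containing a standard body cannot have its boundary too close to the origin. -/
lemma le_of_forall_inner_le (h : IsStdBody n Ω) {c R t : ℝ}
    (hball : ∀ y : EuclideanSpace ℝ (Fin n),
      c * ‖y‖ ^ 2 ≤ ∫ x in ball (0 : EuclideanSpace ℝ (Fin n)) 1, ⟪y, x⟫ ^ 2)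
    (hR : Ω ⊆ ball 0 R) (ht : 0 ≤ t) {y : EuclideanSpace ℝ (Fin n)} (hy : y ≠ 0)
    (hlt : ∀ x ∈ Ω, ⟪y, x⟫ ≤ ‖y‖ * t) : c ≤ 2 * t * R * volume.real Ω := by
  have hyn : 0 < ‖y‖ := norm_pos_iff.2 hy
  have hRn : ∀ x ∈ Ω, ‖x‖ ≤ R := fun x hx => by simpa using (mem_ball.1 (hR hx)).le
  have hle : ∫ x in Ω, ⟪y, x⟫ ^ 2 ≤ ∫ x in Ω, ‖y‖ * R * (2 * (‖y‖ * t) - ⟪y, x⟫) := by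
    refine setIntegral_mono_on (Continuous.integrableOn_of_isBounded (by fun_prop) h.2.2.1)
      (Continuous.integrableOn_of_isBounded (by fun_prop) h.2.2.1) h.1.measurableSet fun x hx => ?_
    have h1 : |⟪y, x⟫| ≤ ‖y‖ * ‖x‖ := abs_real_inner_le_norm _ _
    have h2 : |⟪y, x⟫| ≤ ‖y‖ * R := h1.trans (by gcongr; exact hRn x hx)
    have h3 : |⟪y, x⟫| ≤ 2 * (‖y‖ * t) - ⟪y, x⟫ :=
      abs_le.2 ⟨by nlinarith [hlt x hx, mul_nonneg hyn.le ht], by linarith [hlt x hx]⟩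
    rw [← sq_abs, sq]
    exact mul_le_mul h2 h3 (abs_nonneg _) ((abs_nonneg _).trans h2)
  rw [integral_const_mul, integral_sub
    (Continuous.integrableOn_of_isBounded (by fun_prop) h.2.2.1)
    (Continuous.integrableOn_of_isBounded (by fun_prop) h.2.2.1), h.integral_inner,
    setIntegral_const, h.integral_sq_inner, smul_eq_mul] at hle
  have := (hball y).trans hle
  have h4 : ‖y‖ ^ 2 * c ≤ ‖y‖ ^ 2 * (2 * t * R * volume.real Ω) := by linarith
  exact le_of_mul_le_mul_left h4 (by positivity)

lemma ball_subset_of_lt (h : IsStdBody n Ω) {c R r : ℝ}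
    (hball : ∀ y : EuclideanSpace ℝ (Fin n),
      c * ‖y‖ ^ 2 ≤ ∫ x in ball (0 : EuclideanSpace ℝ (Fin n)) 1, ⟪y, x⟫ ^ 2)
    (hR : Ω ⊆ ball 0 R) (hr : 0 ≤ r) (hrc : 2 * r * R * volume.real Ω < c) :
    closedBall 0 r ⊆ Ω := by
  intro p hp
  by_contra hpΩ
  obtain ⟨f, hf⟩ := geometric_hahn_banach_open_point h.2.1 h.1 hpΩ
  obtain ⟨y, rfl⟩ := (InnerProductSpace.toDual ℝ (EuclideanSpace ℝ (Fin n))).surjective f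
  simp only [InnerProductSpace.toDual_apply_apply] at hf
  obtain ⟨x₀, hx₀⟩ := h.2.2.2.1
  have hy : y ≠ 0 := by
    rintro rfl
    simpa using hf x₀ hx₀
  refine (h.le_of_forall_inner_le hball hR hr hy fun x hx => (hf x hx).le.trans ?_).not_gt hrc
  refine (real_inner_le_norm y p).trans ?_
  gcongr
  simpa using hp

lemma zero_mem (h : IsStdBody n Ω) : (0 : EuclideanSpace ℝ (Fin n)) ∈ Ω := by
  obtain ⟨c, hc, hball⟩ := exists_pos_mul_sq_norm_le_integral_ball n
  obtain ⟨R, hR⟩ := h.2.2.1.subset_ball (0 : EuclideanSpace ℝ (Fin n))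
  exact h.ball_subset_of_lt hball hR le_rfl (by simpa using hc) (by simp)

lemma volume_closure_eq (h : IsStdBody n Ω) : volume (closure Ω) = volume Ω :=
  measure_closure_of_null_frontier (h.2.1.addHaar_frontier volume)

end IsStdBody

section Simplex

variable {n : ℕ}

lemma volume_real_openSimplex_pos (n : ℕ) :
    0 < volume.real {x : EuclideanSpace ℝ (Fin n) | (∀ i, 0 < x i) ∧ ∑ i, x i < 1} := by
  set S := {x : EuclideanSpace ℝ (Fin n) | (∀ i, 0 < x i) ∧ ∑ i, x i < 1}
  have hopen : IsOpen S := by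
    refine IsOpen.and ?_ (isOpen_lt (by fun_prop) continuous_const)
    simp only [ofPred_forall]
    exact isOpen_iInter_of_finite fun i => isOpen_lt continuous_const (by fun_prop)
  have hne : S.Nonempty := by
    refine ⟨WithLp.toLp 2 fun _ => 1 / ((n : ℝ) + 1), fun i => ?_, ?_⟩
    · simp only []; positivity
    · simp only [Finset.sum_const, Finset.card_univ, Fintype.card_fin, nsmul_eq_mul]
      rw [mul_one_div, div_lt_one (by positivity)]
      linarith
  have hbdd : S ⊆ closedBall 0 (Real.sqrt n) := by
    intro x hx
    rw [mem_closedBall_zero_iff, EuclideanSpace.norm_eq]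
    refine Real.sqrt_le_sqrt ?_
    have : ∀ i ∈ Finset.univ, ‖x i‖ ^ 2 ≤ 1 := fun i _ => by
      rw [Real.norm_of_nonneg (hx.1 i).le]
      have h1 : x i ≤ ∑ j, x j :=
        Finset.single_le_sum (fun j _ => (hx.1 j).le) (Finset.mem_univ i)
      have := hx.1 i
      have := hx.2
      nlinarith
    simpa using Finset.sum_le_sum this
  exact ENNReal.toReal_pos (hopen.measure_pos _ hne).ne'
    ((measure_mono hbdd).trans_lt measure_closedBall_lt_top).ne

/-- A convex set containing the origin and the vectors `p i` contains a linear image of the open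
simplex, of volume proportional to the determinant of `p`. -/
lemma abs_det_mul_volume_openSimplex_le {K : Set (EuclideanSpace ℝ (Fin n))} (hK : Convex ℝ K)
    (hKv : volume K ≠ ⊤) (h0 : 0 ∈ K) {p : Fin n → EuclideanSpace ℝ (Fin n)}
    (hp : ∀ i, p i ∈ K) :
    |(EuclideanSpace.basisFun (Fin n) ℝ).toBasis.det p| *
        volume.real {x : EuclideanSpace ℝ (Fin n) | (∀ i, 0 < x i) ∧ ∑ i, x i < 1} ≤
      volume.real K := by
  set e := (EuclideanSpace.basisFun (Fin n) ℝ).toBasis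
  set S := {x : EuclideanSpace ℝ (Fin n) | (∀ i, 0 < x i) ∧ ∑ i, x i < 1}
  set A : EuclideanSpace ℝ (Fin n) →ₗ[ℝ] EuclideanSpace ℝ (Fin n) := e.constr ℝ p with hA
  have hAe : A ∘ e = p := funext fun i => e.constr_basis ℝ p i
  have hdet : LinearMap.det A = e.det p := by
    rw [← hAe, Module.Basis.det_comp, Module.Basis.det_self, mul_one]
  have hsub : A '' S ⊆ K := by
    rintro _ ⟨x, hx, rfl⟩
    have hAx : A x = (1 - ∑ i, x i) • (0 : EuclideanSpace ℝ (Fin n)) + ∑ i, x i • p i := by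
      rw [hA, Module.Basis.constr_apply_fintype]
      simp [e]
    have h := hK.sum_mem (t := Finset.univ)
      (w := fun o : Option (Fin n) => o.elim (1 - ∑ i, x i) fun i => x i)
      (z := fun o => o.elim 0 p) ?_ ?_ ?_
    · rw [Fintype.sum_option] at h
      rw [hAx]
      exact h
    · rintro (_ | i) -
      · exact sub_nonneg.2 hx.2.le
      · exact (hx.1 i).le
    · rw [Fintype.sum_option]; simp
    · rintro (_ | i) -
      · exact h0
      · exact hp i
  have := ENNReal.toReal_mono hKv (measure_mono hsub)
  rwa [Measure.addHaar_image_linearMap, ENNReal.toReal_mul,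
    ENNReal.toReal_ofReal (abs_nonneg _), hdet] at this

end Simplex

namespace IsStdBody

variable {n : ℕ} {Ω : Set (EuclideanSpace ℝ (Fin n))}

/-- The points of the closure spanning a parallelepiped of maximal volume form a basis in which
all coordinates of points of the body are at most `1`. -/
lemma exists_basis_abs_coord_le_one (h : IsStdBody n Ω) :
    ∃ b : Module.Basis (Fin n) ℝ (EuclideanSpace ℝ (Fin n)),
      (∀ i, b i ∈ closure Ω) ∧ ∀ i, ∀ x ∈ Ω, |b.coord i x| ≤ 1 := by
  set e := (EuclideanSpace.basisFun (Fin n) ℝ).toBasis with he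
  have hK : IsCompact (closure Ω) := h.2.2.1.isCompact_closure
  have h0 := h.zero_mem
  have hcont : Continuous fun p : Fin n → EuclideanSpace ℝ (Fin n) => |e.det p| := by
    simp only [Module.Basis.det_apply]
    refine (Continuous.matrix_det (continuous_matrix fun i j => ?_)).abs
    simp only [Module.Basis.toMatrix_apply, he, OrthonormalBasis.coe_toBasis_repr_apply,
      EuclideanSpace.basisFun_repr]
    fun_prop
  obtain ⟨p, hp, hmax⟩ := (isCompact_univ_pi fun _ : Fin n => hK).exists_isMaxOn
    ⟨fun _ => 0, fun _ _ => subset_closure h0⟩ hcont.continuousOn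
  have hdet : 0 < |e.det p| := by
    obtain ⟨ε, hε, hεΩ⟩ := Metric.isOpen_iff.1 h.1 0 h0
    have hmem : (fun i => (ε / 2) • e i) ∈ univ.pi fun _ : Fin n => closure Ω := fun i _ => by
      refine subset_closure (hεΩ ?_)
      rw [mem_ball_zero_iff, norm_smul, Real.norm_of_nonneg (by positivity)]
      simp only [he, OrthonormalBasis.coe_toBasis, OrthonormalBasis.norm_eq_one]
      linarith
    have h1 := hmax hmem
    have h2 : e.det (fun i => (ε / 2) • e i) = (ε / 2) ^ n := by
      have := e.det.map_smul_univ (fun _ => ε / 2) e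
      rw [this, Module.Basis.det_self]
      simp [div_pow]
    refine lt_of_lt_of_le ?_ h1
    simp only [h2]
    positivity
  obtain ⟨hli, hsp⟩ := e.is_basis_iff_det.2 (isUnit_iff_ne_zero.2 (abs_pos.1 hdet))
  refine ⟨Module.Basis.mk hli hsp.ge, fun i => ?_, fun i x hx => ?_⟩
  · simpa using hp i (mem_univ i)
  · have hc := congrArg (fun f => |f x|) (e.det_smul_mk_coord_eq_det_update hli hsp.ge i)
    simp only [LinearMap.smul_apply, smul_eq_mul, abs_mul,
      MultilinearMap.toLinearMap_apply] at hc
    have hmem : Function.update p i x ∈ univ.pi fun _ : Fin n => closure Ω := fun j _ => by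
      rcases eq_or_ne j i with rfl | hj
      · simpa using subset_closure hx
      · simpa [hj] using hp j (mem_univ j)
    have h1 : |e.det (Function.update p i x)| ≤ |e.det p| := hmax hmem
    have h2 : |e.det p| * |(Module.Basis.mk hli hsp.ge).coord i x| ≤ |e.det p| * 1 := by
      rw [hc, mul_one]; exact h1
    exact le_of_mul_le_mul_left h2 hdet

lemma exists_pos_le_volume_real (n : ℕ) :
    ∃ δ : ℝ, 0 < δ ∧ ∀ Ω : Set (EuclideanSpace ℝ (Fin n)), IsStdBody n Ω →
      δ ≤ volume.real Ω := by
  obtain ⟨c, hc, hball⟩ := exists_pos_mul_sq_norm_le_integral_ball n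
  have hs := volume_real_openSimplex_pos n
  set s := volume.real {x : EuclideanSpace ℝ (Fin n) | (∀ i, 0 < x i) ∧ ∑ i, x i < 1}
  set t := Real.sqrt (1 / c) with ht
  have ht0 : 0 < t := by positivity
  refine ⟨min 1 (s / (n.factorial * t ^ n)), by positivity, fun Ω h => ?_⟩
  rcases le_total 1 (volume.real Ω) with hV | hV
  · exact (min_le_left _ _).trans hV
  refine (min_le_right _ _).trans ?_
  obtain ⟨b, hbK, hb⟩ := h.exists_basis_abs_coord_le_one
  set e := (EuclideanSpace.basisFun (Fin n) ℝ).toBasis with he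
  have hvK : volume.real (closure Ω) = volume.real Ω := by
    rw [Measure.real, h.volume_closure_eq, Measure.real]
  have h1 : |e.det b| * s ≤ volume.real Ω := by
    rw [← hvK]
    exact abs_det_mul_volume_openSimplex_le h.2.1.closure
      (by rw [h.volume_closure_eq]; exact h.volume_lt_top.ne) (subset_closure h.zero_mem) hbK
  have hentry : ∀ i j, |b.toMatrix e i j| ≤ t := by
    intro i j
    rw [Module.Basis.toMatrix_apply, ← Module.Basis.coord_apply]
    obtain ⟨y, hy⟩ := (InnerProductSpace.toDual ℝ (EuclideanSpace ℝ (Fin n))).surjective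
      (LinearMap.toContinuousLinearMap (b.coord i))
    have hy' : ∀ x, b.coord i x = ⟪y, x⟫ := fun x => by
      rw [← InnerProductSpace.toDual_apply_apply, hy]; rfl
    have hyV : c * ‖y‖ ^ 2 ≤ 1 := by
      refine ((hball y).trans_eq (h.integral_sq_inner y).symm).trans (le_trans ?_ hV)
      calc ∫ x in Ω, ⟪y, x⟫ ^ 2 ≤ ∫ x in Ω, (1 : ℝ) := by
            refine setIntegral_mono_on (Continuous.integrableOn_of_isBounded (by fun_prop) h.2.2.1)
              (Continuous.integrableOn_of_isBounded (by fun_prop) h.2.2.1) h.1.measurableSet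
              fun x hx => ?_
            rw [← hy', sq_le_one_iff_abs_le_one]
            exact hb i x hx
        _ = volume.real Ω := by simp
    have hyt : ‖y‖ ≤ t := by
      refine Real.le_sqrt_of_sq_le ?_
      rw [le_div_iff₀ hc]; linarith
    rw [hy']
    refine (abs_real_inner_le_norm _ _).trans ?_
    simpa [he] using hyt
  have hdet : |b.det e| ≤ n.factorial * t ^ n := by
    have := Matrix.det_le (abv := AbsoluteValue.abs) (A := b.toMatrix e) hentry
    simpa [Module.Basis.det_apply, nsmul_eq_mul] using this
  have hmul : |b.det e| * |e.det b| = 1 := by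
    rw [← abs_mul, Module.Basis.det_mul_det, Module.Basis.det_self, abs_one]
  rw [div_le_iff₀ (by positivity)]
  calc s = |b.det e| * (|e.det b| * s) := by rw [← mul_assoc, hmul, one_mul]
    _ ≤ (n.factorial * t ^ n) * volume.real Ω := by gcongr
    _ = _ := mul_comm _ _

/-- Standard bodies are uniformly pinched between two balls. -/
lemma exists_ball_subset_subset_ball (n : ℕ) :
    ∃ r R : ℝ, 0 < r ∧ r < R ∧ ∀ Ω : Set (EuclideanSpace ℝ (Fin n)), IsStdBody n Ω →
      ball 0 r ⊆ Ω ∧ Ω ⊆ ball 0 R := by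
  obtain ⟨c, hc, hball⟩ := exists_pos_mul_sq_norm_le_integral_ball n
  obtain ⟨δ, hδ, hV⟩ := exists_pos_le_volume_real n
  set β := 2 ^ (n + 2) * volume.real (ball (0 : EuclideanSpace ℝ (Fin n)) 1)
  have hβ : 0 ≤ β := by positivity
  set R := Real.sqrt (β / δ) + 1
  have hR : 0 < R := by positivity
  have hout : ∀ Ω : Set (EuclideanSpace ℝ (Fin n)), IsStdBody n Ω → Ω ⊆ ball 0 R := by
    intro Ω h p hp
    have h1 : ‖p‖ ^ 2 * δ ≤ β :=
      (mul_le_mul_of_nonneg_left (hV Ω h) (by positivity)).trans (h.sq_norm_mul_volume_le hp)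
    have h2 : ‖p‖ ≤ Real.sqrt (β / δ) := Real.le_sqrt_of_sq_le (by rwa [le_div_iff₀ hδ])
    rw [mem_ball_zero_iff]
    exact h2.trans_lt (lt_add_one _)
  set W := volume.real (ball (0 : EuclideanSpace ℝ (Fin n)) R)
  have hW : 0 < W := ENNReal.toReal_pos (measure_ball_pos _ _ hR).ne' measure_ball_lt_top.ne
  have hr : 0 < min (R / 2) (c / (4 * R * W)) := by positivity
  refine ⟨min (R / 2) (c / (4 * R * W)), R, hr, (min_le_left _ _).trans_lt (half_lt_self hR),
    fun Ω h => ⟨ball_subset_closedBall.trans ?_, hout Ω h⟩⟩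
  refine h.ball_subset_of_lt hball (hout Ω h) hr.le ?_
  have hVW : volume.real Ω ≤ W := measureReal_mono (hout Ω h) measure_ball_lt_top.ne
  calc 2 * min (R / 2) (c / (4 * R * W)) * R * volume.real Ω
      ≤ 2 * (c / (4 * R * W)) * R * W := by gcongr; exact min_le_right _ _
    _ = c / 2 := by field_simp; norm_num
    _ < c := half_lt_self hc

lemma setIntegral_closure (h : IsStdBody n Ω) {F : Type*} [NormedAddCommGroup F] [NormedSpace ℝ F]
    (f : EuclideanSpace ℝ (Fin n) → F) : ∫ x in closure Ω, f x = ∫ x in Ω, f x :=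
  setIntegral_congr_set (closure_ae_eq_of_null_frontier (h.2.1.addHaar_frontier volume))

end IsStdBody

section Limit

open TopologicalSpace

lemma tendsto_infDist_of_tendsto_nonemptyCompacts {α : Type*} [MetricSpace α]
    {u : ℕ → NonemptyCompacts α} {K : NonemptyCompacts α} (hu : Tendsto u atTop (𝓝 K)) (x : α) :
    Tendsto (fun k => infDist x (u k)) atTop (𝓝 (infDist x K)) :=
  ((lipschitz_infDist_set x).continuous.tendsto K).comp hu

lemma mem_of_tendsto_nonemptyCompacts {α : Type*} [MetricSpace α]
    {u : ℕ → NonemptyCompacts α} {K : NonemptyCompacts α}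
    (hu : Tendsto u atTop (𝓝 K)) {x : α} (hx : ∀ k, x ∈ u k) : x ∈ K := by
  have hlim := tendsto_infDist_of_tendsto_nonemptyCompacts hu x
  rw [← SetLike.mem_coe, K.isCompact.isClosed.mem_iff_infDist_zero K.nonempty]
  refine tendsto_nhds_unique hlim ?_
  simpa only [fun k => infDist_zero_of_mem (SetLike.mem_coe.2 (hx k))] using tendsto_const_nhds

lemma eventually_notMem_of_tendsto_nonemptyCompacts {α : Type*} [MetricSpace α]
    {u : ℕ → NonemptyCompacts α} {K : NonemptyCompacts α} (hu : Tendsto u atTop (𝓝 K)) {x : α} (hx : x ∉ K) :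
    ∀ᶠ k in atTop, x ∉ u k := by
  have hlim := tendsto_infDist_of_tendsto_nonemptyCompacts hu x
  have hpos : 0 < infDist x (K : Set α) :=
    (K.isCompact.isClosed.notMem_iff_infDist_pos K.nonempty).1 hx
  filter_upwards [hlim.eventually_const_lt hpos] with k hk hxk
  exact hk.ne' (infDist_zero_of_mem hxk)

variable {E : Type*} [NormedAddCommGroup E] [NormedSpace ℝ E]

lemma convex_of_tendsto_nonemptyCompacts {u : ℕ → NonemptyCompacts E} {K : NonemptyCompacts E}
    (hu : Tendsto u atTop (𝓝 K)) (hconv : ∀ k, Convex ℝ (u k : Set E)) :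
    Convex ℝ (K : Set E) := by
  have hlim := tendsto_infDist_of_tendsto_nonemptyCompacts hu
  intro x hx y hy a b ha hb hab
  refine (K.isCompact.isClosed.mem_iff_infDist_zero K.nonempty).2 ?_
  replace hx : infDist x (K : Set E) = 0 := infDist_zero_of_mem hx
  replace hy : infDist y (K : Set E) = 0 := infDist_zero_of_mem hy
  have hle : ∀ k, infDist (a • x + b • y) (u k) ≤ a * infDist x (u k) + b * infDist y (u k) := by
    intro k
    obtain ⟨x', hx', hxd⟩ := (u k).isCompact.exists_infDist_eq_dist (u k).nonempty x
    obtain ⟨y', hy', hyd⟩ := (u k).isCompact.exists_infDist_eq_dist (u k).nonempty y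
    refine (infDist_le_dist_of_mem (hconv k hx' hy' ha hb hab)).trans ?_
    rw [hxd, hyd]
    refine (dist_add_add_le _ _ _ _).trans_eq ?_
    rw [dist_smul₀, dist_smul₀, Real.norm_of_nonneg ha, Real.norm_of_nonneg hb]
  have h := le_of_tendsto_of_tendsto' (hlim _)
    (((hlim x).const_mul a).add ((hlim y).const_mul b)) hle
  rw [hx, hy, mul_zero, mul_zero, add_zero] at h
  exact le_antisymm h infDist_nonneg

lemma eventually_mem_of_tendsto_nonemptyCompacts {u : ℕ → NonemptyCompacts E}
    {K : NonemptyCompacts E} (hu : Tendsto u atTop (𝓝 K)) (hconv : ∀ k, Convex ℝ (u k : Set E))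
    {r : ℝ} (hr : 0 < r) (hball : ∀ k, ball 0 r ⊆ (u k : Set E)) {x : E}
    (hx : x ∈ interior (K : Set E)) : ∀ᶠ k in atTop, x ∈ u k := by
  obtain ⟨δ, hδ, hδK⟩ : ∃ δ : ℝ, 0 < δ ∧ (1 + δ) • x ∈ (K : Set E) := by
    have hc : Tendsto (fun δ : ℝ => (1 + δ) • x) (𝓝[>] 0) (𝓝 x) := by
      have : ContinuousAt (fun δ : ℝ => (1 + δ) • x) 0 := by fun_prop
      simpa [ContinuousAt] using this.tendsto.mono_left nhdsWithin_le_nhds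
    obtain ⟨δ, h1, h2⟩ :=
      ((hc.eventually_mem (mem_interior_iff_mem_nhds.1 hx)).and self_mem_nhdsWithin).exists
    exact ⟨δ, h2, h1⟩
  have hlim : Tendsto (fun k => infDist ((1 + δ) • x) (u k)) atTop (𝓝 0) := by
    have := tendsto_infDist_of_tendsto_nonemptyCompacts hu ((1 + δ) • x)
    rwa [infDist_zero_of_mem hδK] at this
  filter_upwards [hlim.eventually_lt_const (by positivity : 0 < δ * r)] with k hk
  obtain ⟨y, hy, hyd⟩ := (infDist_lt_iff (u k).nonempty).1 hk
  have hz : δ⁻¹ • ((1 + δ) • x - y) ∈ (u k : Set E) := by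
    refine hball k ?_
    rw [mem_ball_zero_iff, norm_smul, norm_inv, Real.norm_of_nonneg hδ.le, inv_mul_lt_iff₀ hδ,
      ← dist_eq_norm]
    exact hyd
  have := hconv k hy hz (a := 1 / (1 + δ)) (b := δ / (1 + δ)) (by positivity) (by positivity)
    (by field_simp)
  rw [← SetLike.mem_coe]
  convert this using 1
  rw [smul_smul, smul_sub, smul_smul]
  have h1 : δ / (1 + δ) * δ⁻¹ = 1 / (1 + δ) := by field_simp
  rw [h1, one_div, inv_mul_cancel₀ (by positivity), one_smul]
  abel

end Limit

section Integral

open TopologicalSpace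

variable {n : ℕ}

/-- Integrals of continuous functions over convex bodies are continuous for Hausdorff limits. -/
lemma tendsto_setIntegral_of_tendsto_nonemptyCompacts
    {u : ℕ → NonemptyCompacts (EuclideanSpace ℝ (Fin n))}
    {K : NonemptyCompacts (EuclideanSpace ℝ (Fin n))} (hu : Tendsto u atTop (𝓝 K))
    (hconv : ∀ k, Convex ℝ (u k : Set (EuclideanSpace ℝ (Fin n)))) {r R : ℝ} (hr : 0 < r)
    (hball : ∀ k, ball 0 r ⊆ (u k : Set (EuclideanSpace ℝ (Fin n))))
    (hR : ∀ k, (u k : Set (EuclideanSpace ℝ (Fin n))) ⊆ closedBall 0 R)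
    {F : Type*} [NormedAddCommGroup F] [NormedSpace ℝ F]
    {f : EuclideanSpace ℝ (Fin n) → F} (hf : Continuous f) :
    Tendsto (fun k => ∫ x in (u k : Set (EuclideanSpace ℝ (Fin n))), f x) atTop
      (𝓝 (∫ x in (K : Set (EuclideanSpace ℝ (Fin n))), f x)) := by
  have hK := convex_of_tendsto_nonemptyCompacts hu hconv
  have hmeas : ∀ L : NonemptyCompacts (EuclideanSpace ℝ (Fin n)),
      MeasurableSet (L : Set (EuclideanSpace ℝ (Fin n))) := fun L => L.isCompact.measurableSet
  simp_rw [← integral_indicator (hmeas _)]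
  refine tendsto_integral_of_dominated_convergence
    ((closedBall 0 R).indicator fun x => ‖f x‖) (fun k => ?_) ?_ (fun k => ae_of_all _ fun x => ?_)
    ?_
  · exact hf.aestronglyMeasurable.indicator (hmeas _)
  · rw [integrable_indicator_iff measurableSet_closedBall]
    exact hf.norm.integrableOn_of_isBounded isBounded_closedBall
  · rw [norm_indicator_eq_indicator_norm]
    exact indicator_le_indicator_of_subset (hR k) (fun _ => norm_nonneg _) x
  · have hfr : ∀ᵐ x, x ∉ frontier (K : Set (EuclideanSpace ℝ (Fin n))) :=
      measure_eq_zero_iff_ae_notMem.1 (hK.addHaar_frontier volume)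
    filter_upwards [hfr] with x hx
    refine tendsto_const_nhds.congr' ?_
    by_cases hxK : x ∈ K
    · have hxi : x ∈ interior (K : Set (EuclideanSpace ℝ (Fin n))) := by
        by_contra hxi
        exact hx ⟨subset_closure hxK, hxi⟩
      filter_upwards [eventually_mem_of_tendsto_nonemptyCompacts hu hconv hr hball hxi] with k hk
      rw [indicator_of_mem (SetLike.mem_coe.2 hk), indicator_of_mem (SetLike.mem_coe.2 hxK)]
    · filter_upwards [eventually_notMem_of_tendsto_nonemptyCompacts hu hxK] with k hk
      rw [indicator_of_notMem (mt SetLike.mem_coe.1 hk),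
        indicator_of_notMem (mt SetLike.mem_coe.1 hxK)]

end Integral

/-- The set `ℰ_s` of standard convex bodies is compact for the Hausdorff
topology on (closures of) bodies, and every standard body is pinched between the balls
`B(O, r_n)` and `B(O, R_n)`. -/
theorem stmt_13 (n : ℕ) (hn : 1 ≤ n) :
    ∃ r R : ℝ, 0 < r ∧ r < R ∧
      (∀ Ω : Set (EuclideanSpace ℝ (Fin n)), IsStdBody n Ω →
        ball (0 : EuclideanSpace ℝ (Fin n)) r ⊆ Ω ∧
          Ω ⊆ ball (0 : EuclideanSpace ℝ (Fin n)) R) ∧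
      IsCompact {K : TopologicalSpace.NonemptyCompacts (EuclideanSpace ℝ (Fin n)) |
        ∃ Ω : Set (EuclideanSpace ℝ (Fin n)), IsStdBody n Ω ∧ (K : Set _) = closure Ω} := by
  obtain ⟨r, R, hr, hrR, hpinch⟩ := IsStdBody.exists_ball_subset_subset_ball n
  refine ⟨r, R, hr, hrR, hpinch, ?_⟩
  refine (TopologicalSpace.NonemptyCompacts.isCompact_subsets_of_isCompact
    (isCompact_closedBall (0 : EuclideanSpace ℝ (Fin n)) R)).of_isClosed_subset ?_ ?_
  swap
  · rintro K ⟨Ω, h, hK⟩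
    rw [mem_ofPred_eq, hK]
    exact closure_minimal ((hpinch Ω h).2.trans ball_subset_closedBall) isClosed_closedBall
  refine IsSeqClosed.isClosed fun u K hu hlim => ?_
  choose Ω hΩ huΩ using hu
  have hconv : ∀ k, Convex ℝ (u k : Set (EuclideanSpace ℝ (Fin n))) := fun k => by
    rw [huΩ]; exact (hΩ k).2.1.closure
  have hball : ∀ k, ball 0 r ⊆ (u k : Set (EuclideanSpace ℝ (Fin n))) := fun k => by
    rw [huΩ]; exact (hpinch _ (hΩ k)).1.trans subset_closure
  have hR : ∀ k, (u k : Set (EuclideanSpace ℝ (Fin n))) ⊆ closedBall 0 R := fun k => by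
    rw [huΩ]
    exact closure_minimal ((hpinch _ (hΩ k)).2.trans ball_subset_closedBall) isClosed_closedBall
  have hK := convex_of_tendsto_nonemptyCompacts hlim hconv
  have hballK : ball 0 r ⊆ (K : Set (EuclideanSpace ℝ (Fin n))) := fun x hx =>
    mem_of_tendsto_nonemptyCompacts hlim fun k => hball k hx
  have h0 : (0 : EuclideanSpace ℝ (Fin n)) ∈ interior (K : Set (EuclideanSpace ℝ (Fin n))) :=
    interior_maximal hballK isOpen_ball (mem_ball_self hr)
  have hint : interior (K : Set (EuclideanSpace ℝ (Fin n))) =ᵐ[volume]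
      (K : Set (EuclideanSpace ℝ (Fin n))) :=
    interior_ae_eq_of_null_frontier (hK.addHaar_frontier volume)
  refine ⟨interior K, ⟨isOpen_interior, hK.interior,
    K.isCompact.isBounded.subset interior_subset, ⟨0, h0⟩, ?_, fun ψ => ?_⟩, ?_⟩
  · rw [setIntegral_congr_set hint]
    refine tendsto_nhds_unique (tendsto_setIntegral_of_tendsto_nonemptyCompacts hlim hconv hr hball
      hR continuous_id) ?_
    simp only [huΩ, (hΩ _).setIntegral_closure, (hΩ _).2.2.2.2.1]
    exact tendsto_const_nhds
  · rw [setIntegral_congr_set hint]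
    have hψ : Continuous fun x => ψ x ^ 2 := ψ.continuous_of_finiteDimensional.pow 2
    refine tendsto_nhds_unique (tendsto_setIntegral_of_tendsto_nonemptyCompacts hlim hconv hr hball
      hR hψ) ?_
    simp only [huΩ, (hΩ _).setIntegral_closure, (hΩ _).2.2.2.2.2 ψ]
    exact tendsto_const_nhds
  · rw [hK.closure_interior_eq_closure_of_nonempty_interior ⟨0, h0⟩,
      K.isCompact.isClosed.closure_eq]
end
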